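/- arXiv:0809.4278 — 2 statements merged into one kernel-verified Lean document; each statement's English description precedes it below -/
import Mathlib

section
/- Let p and q be odd integers with 7 ≤ p ≤ q, assume q ≥ 21 if p = 7, and assume (p,q) ≠ (9,9). Then the presented group Γ_{2(p+q)+1}(p,q) is infinite. -/
/-- The relators of the presented group `Γ_s(p,q)`, the fundamental group of `s`-surgery
on the `(-2,p,q)` pretzel knot (via the Wirtinger presentation), on generators
`x = of 0`, `y = of 1`, `z = of 2`. -/
def pretzelRels (p q s : ℤ) : Set (FreeGroup (Fin 3)) :=
  let x : FreeGroup (Fin 3) := FreeGroup.of 0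
  let y : FreeGroup (Fin 3) := FreeGroup.of 1
  let z : FreeGroup (Fin 3) := FreeGroup.of 2
  let l : FreeGroup (Fin 3) :=
    x ^ (-2 * (p + q)) * (y * x) ^ ((q - 1) / 2) * (y * z⁻¹)⁻¹ * (y * x) ^ ((q + 1) / 2) *
      (z * x) ^ ((p - 1) / 2) * (y * z⁻¹) * (z * x) ^ ((p + 1) / 2)
  { (z * x) ^ ((p - 1) / 2) * z * (z * x) ^ (-((p - 1) / 2)) *
      ((y * x) ^ (-((q + 1) / 2)) * y * (y * x) ^ ((q + 1) / 2))⁻¹,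
    (y * z⁻¹)⁻¹ * y * (y * z⁻¹) *
      ((y * x) ^ (-((q - 1) / 2)) * x * (y * x) ^ ((q - 1) / 2))⁻¹,
    (y * z⁻¹)⁻¹ * z * (y * z⁻¹) *
      ((z * x) ^ ((p + 1) / 2) * x * (z * x) ^ (-((p + 1) / 2)))⁻¹,
    x ^ s * l }

open scoped Quaternion

set_option linter.all false


/-- group lemma -/
theorem pz_group {G : Type*} [Group G] (A B x x' : G) (a b : ℕ)
    (h1 : x' * A ^ a * x = A ^ (a+1)) (h2 : x * B ^ b * x' = B ^ (b+1))
    (h3 : x⁻¹ * B * A⁻¹ * x' = A⁻¹ * B)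
    (h4 : x * B ^ b * A * B ^ b * A ^ a * B * A ^ a = 1) :
    let z := A * x⁻¹
    let y := B * x⁻¹
    (z * x) ^ a * z * ((z*x) ^ a)⁻¹ = ((y*x) ^ (b+1))⁻¹ * y * (y*x) ^ (b+1) ∧
    (y * z⁻¹)⁻¹ * y * (y * z⁻¹) = ((y*x)^b)⁻¹ * x * (y*x)^b ∧
    (y * z⁻¹)⁻¹ * z * (y * z⁻¹) = (z*x)^(a+1) * x * ((z*x)^(a+1))⁻¹ ∧
    x * ((y*x)^b * (y * z⁻¹)⁻¹ * (y*x)^(b+1) * (z*x)^a * (y * z⁻¹) * (z*x)^(a+1)) = 1 := by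
  intro z y
  have hz : z * x = A := by simp [z]
  have hy : y * x = B := by simp [y]
  have hC : y * z⁻¹ = B * A⁻¹ := by simp [y, z]
  rw [hz, hy, hC]
  have hx1 : x' = A ^ (a+1) * x⁻¹ * (A^a)⁻¹ := by rw [← h1]; group
  have hx2 : x' = (B^b)⁻¹ * x⁻¹ * B^(b+1) := by rw [← h2]; group
  have hx3 : x' = A * B⁻¹ * x * A⁻¹ * B := by
    have : A * B⁻¹ * x * (x⁻¹ * B * A⁻¹ * x') = A * B⁻¹ * x * (A⁻¹ * B) := by rw [h3]
    rw [← mul_assoc] at this; simpa [mul_assoc] using this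
  have e1 : A^a * z * (A^a)⁻¹ = x' := by
    rw [hx1, pow_succ]; simp [z, mul_assoc]
  have e2 : (B^(b+1))⁻¹ * y * B^(b+1) = x' := by
    rw [hx2, pow_succ']; simp [y, mul_assoc]
  have e3 : (B*A⁻¹)⁻¹ * y * (B*A⁻¹) = B * x'⁻¹ := by
    rw [hx3]; simp [y, mul_assoc]
  have e3' : (B^b)⁻¹ * x * B^b = B * x'⁻¹ := by
    rw [hx2, pow_succ]; simp [mul_assoc]
  have e4 : (B*A⁻¹)⁻¹ * z * (B*A⁻¹) = A * x'⁻¹ := by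
    rw [hx3]; simp [z, mul_assoc]
  have e4' : A^(a+1) * x * (A^(a+1))⁻¹ = A * x'⁻¹ := by
    rw [hx1, pow_succ']; simp [mul_assoc]
  refine ⟨by rw [e1, e2], by rw [e3, e3'], by rw [e4, e4'], ?_⟩
  rw [← h4, pow_succ', pow_succ']
  simp [mul_assoc]

@[ext] structure V4 where
  a0 : ℝ
  a1 : ℝ
  a2 : ℝ
  a3 : ℝ

/-- product in the basis 1, A, B, AB -/
def V4.mul (ca cb c : ℝ) (x y : V4) : V4 :=
  ⟨x.a0 * y.a0 + (-x.a1 - 2*c*x.a2 - 2*cb*x.a3) * y.a1 - x.a2 * y.a2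
      - (2*ca*x.a2 + x.a3) * y.a3,
   x.a1 * y.a0 + (x.a0 + 2*ca*x.a1 + 2*cb*x.a2 + (4*ca*cb-2*c)*x.a3) * y.a1 - x.a3 * y.a2
      + x.a2 * y.a3,
   x.a2 * y.a0 + (2*ca*x.a2 + x.a3) * y.a1 + (x.a0 + 2*cb*x.a2) * y.a2
      + ((-x.a1 - 2*c*x.a2 - 2*cb*x.a3) + 2*cb*(2*ca*x.a2 + x.a3)) * y.a3,
   x.a3 * y.a0 - x.a2 * y.a1 + (x.a1 + 2*cb*x.a3) * y.a2
      + ((x.a0 + 2*ca*x.a1 + 2*cb*x.a2 + (4*ca*cb-2*c)*x.a3) - 2*cb*x.a2) * y.a3⟩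

noncomputable def V4.toH (A B : ℍ[ℝ]) (x : V4) : ℍ[ℝ] :=
  x.a0 • (1:ℍ[ℝ]) + x.a1 • A + x.a2 • B + x.a3 • (A * B)

theorem V4.toH_mul (A B : ℍ[ℝ]) (ca cb c : ℝ) (hA : A * A = (2*ca) • A - 1)
    (hB : B * B = (2*cb) • B - 1)
    (hBA : B * A = (2*cb) • A + (2*ca) • B - (2*c) • 1 - A * B) (x y : V4) :
    (V4.mul ca cb c x y).toH A B = x.toH A B * y.toH A B := by
  have hAAB : A * (A * B) = (2*ca) • (A * B) - B := by
    rw [← mul_assoc, hA]; simp [sub_mul]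
  have hABB : A * B * B = (2*cb) • (A * B) - A := by
    rw [mul_assoc, hB]; simp [mul_sub]
  have hBAB : B * (A * B) = (2*cb) • (A*B) + (2*ca) • ((2*cb) • B - 1) - (2*c) • B - ((2*cb) • (A * B) - A) := by
    rw [← mul_assoc, hBA, sub_mul, sub_mul, add_mul, hABB]; simp [hB]
  have hABA : A * B * A = (2*cb) • ((2*ca) • A - 1) + (2*ca) • (A*B) - (2*c) • A - ((2*ca) • (A * B) - B) := by
    rw [mul_assoc, hBA, mul_sub, mul_sub, mul_add, hAAB]; simp [hA]
  have hABAB : A * B * (A * B) = (2*cb) • ((2*ca) • (A*B) - B) + (2*ca) • ((2*cb) • (A * B) - A) - (2*c) • (A*B) - ((2*ca) • ((2*cb) • (A * B) - A) - ((2*cb) • B - 1)) := by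
    rw [← mul_assoc, hABA]; simp only [sub_mul, add_mul, smul_mul_assoc, hABB, hB, one_mul]
  simp only [V4.toH, V4.mul, mul_add, add_mul, smul_mul_smul_comm, hAAB, hABB, hBAB, hABA, hABAB, hA, hB, hBA, mul_one, one_mul]
  module


/-! ### The rational parametrisation -/

def pzS (i j : ℝ) : ℝ := 1 - i*j
def pzE (i j : ℝ) : ℝ := 3 + i + j - i*j
def pzY (i j : ℝ) : ℝ := i + j + 3*(i*j) - (i*j)^2
def pzXA (i j : ℝ) : ℝ := 1 - i - 4*(i*j) - j*(i*j) + (i*j)^2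
def pzXB (i j : ℝ) : ℝ := 1 - j - 4*(i*j) - i*(i*j) + (i*j)^2
def pzNA (i j : ℝ) : ℝ := 2*pzS i j*pzY i j - pzE i j * i * pzXA i j
def pzNB (i j : ℝ) : ℝ := 2*pzS i j*pzY i j - pzE i j * j * pzXB i j
def pzNC (i j : ℝ) : ℝ := 2*(pzS i j)^2 - pzE i j * (1 - 4*(i*j) + (i*j)^2 - i - j)
noncomputable def pzca (i j : ℝ) : ℝ := pzNA i j / (2*pzS i j*pzY i j)
noncomputable def pzcb (i j : ℝ) : ℝ := pzNB i j / (2*pzS i j*pzY i j)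
noncomputable def pzc (i j : ℝ) : ℝ := pzNC i j / (2*(pzS i j)^2)
def pzdA (i j : ℝ) : ℝ := 1 + 3*i + i^2 - i*(i*j)
def pzdB (i j : ℝ) : ℝ := 1 + 3*j + j^2 - j*(i*j)

def vA : V4 := ⟨0,1,0,0⟩
def vB : V4 := ⟨0,0,1,0⟩
noncomputable def vAi (i j : ℝ) : V4 := ⟨2*pzca i j, -1, 0, 0⟩
noncomputable def vBi (i j : ℝ) : V4 := ⟨2*pzcb i j, 0, -1, 0⟩
noncomputable def vR (i j : ℝ) : V4 :=
  ⟨((pzY i j)^2 - pzNA i j*(1+j) - pzNB i j*(1+i))/pzY i j, pzS i j*(1+j), pzS i j*(1+i), 0⟩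
def vR' (i j : ℝ) : V4 := ⟨pzY i j, -(pzS i j*(1+j)), -(pzS i j*(1+i)), 0⟩
noncomputable def vP (i j : ℝ) : V4 := ⟨pzdA i j - pzNA i j/pzY i j, pzS i j, 0, 0⟩
noncomputable def vQ (i j : ℝ) : V4 := ⟨pzdB i j - pzNB i j/pzY i j, 0, pzS i j, 0⟩
def vP' (i j : ℝ) : V4 := ⟨pzdA i j, -pzS i j, 0, 0⟩
def vQ' (i j : ℝ) : V4 := ⟨pzdB i j, 0, -pzS i j, 0⟩
noncomputable def vW (i j : ℝ) : V4 :=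
  ⟨pzdB i j - pzNB i j/pzY i j - pzNA i j*(1+j)/(pzS i j*pzY i j), 1+j, pzS i j, 0⟩
noncomputable def vBPB (i j : ℝ) : V4 := ⟨-pzdA i j, pzS i j, i*pzE i j*(1+i)*pzS i j/pzY i j, 0⟩
noncomputable def vAQA (i j : ℝ) : V4 := ⟨-pzdB i j, j*pzE i j*(1+j)*pzS i j/pzY i j, pzS i j, 0⟩
noncomputable def vPAi (i j : ℝ) : V4 :=
  ⟨2*pzca i j*(pzdA i j-pzNA i j/pzY i j)+pzS i j, -(pzdA i j-pzNA i j/pzY i j), 0, 0⟩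
noncomputable def vBiQ (i j : ℝ) : V4 :=
  ⟨2*pzcb i j*(pzdB i j-pzNB i j/pzY i j)+pzS i j, 0, -(pzdB i j-pzNB i j/pzY i j), 0⟩

/-- the product attached to the parameters -/
noncomputable def vm (i j : ℝ) : V4 → V4 → V4 := V4.mul (pzca i j) (pzcb i j) (pzc i j)

set_option maxHeartbeats 1000000 in
theorem pz_RR' {i j : ℝ} (hS : pzS i j ≠ 0) (hY : pzY i j ≠ 0) :
    vm i j (vR i j) (vR' i j) = ⟨((1+i)*(1+j))^2,0,0,0⟩ := by
  ext <;> simp only [vm, V4.mul, pzca, pzcb, pzc, vR, vR'] <;> field_simp <;>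
    simp only [pzNA, pzNB, pzNC, pzXA, pzXB, pzdA, pzdB, pzS, pzY, pzE] <;> ring

set_option maxHeartbeats 1000000 in
theorem pz_R'R {i j : ℝ} (hS : pzS i j ≠ 0) (hY : pzY i j ≠ 0) :
    vm i j (vR' i j) (vR i j) = ⟨((1+i)*(1+j))^2,0,0,0⟩ := by
  ext <;> simp only [vm, V4.mul, pzca, pzcb, pzc, vR, vR'] <;> field_simp <;>
    simp only [pzNA, pzNB, pzNC, pzXA, pzXB, pzdA, pzdB, pzS, pzY, pzE] <;> ring

set_option maxHeartbeats 1000000 in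
theorem pz_PP' {i j : ℝ} (hS : pzS i j ≠ 0) (hY : pzY i j ≠ 0) :
    vm i j (vP i j) (vP' i j) = ⟨i*pzE i j*(1+i)^2*pzS i j/pzY i j,0,0,0⟩ := by
  ext <;> simp only [vm, V4.mul, pzca, pzcb, pzc, vP, vP'] <;> field_simp <;>
    simp only [pzNA, pzNB, pzNC, pzXA, pzXB, pzdA, pzdB, pzS, pzY, pzE] <;> ring

set_option maxHeartbeats 1000000 in
theorem pz_P'P {i j : ℝ} (hS : pzS i j ≠ 0) (hY : pzY i j ≠ 0) :
    vm i j (vP' i j) (vP i j) = ⟨i*pzE i j*(1+i)^2*pzS i j/pzY i j,0,0,0⟩ := by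
  ext <;> simp only [vm, V4.mul, pzca, pzcb, pzc, vP, vP'] <;> field_simp <;>
    simp only [pzNA, pzNB, pzNC, pzXA, pzXB, pzdA, pzdB, pzS, pzY, pzE] <;> ring

set_option maxHeartbeats 1000000 in
theorem pz_QQ' {i j : ℝ} (hS : pzS i j ≠ 0) (hY : pzY i j ≠ 0) :
    vm i j (vQ i j) (vQ' i j) = ⟨j*pzE i j*(1+j)^2*pzS i j/pzY i j,0,0,0⟩ := by
  ext <;> simp only [vm, V4.mul, pzca, pzcb, pzc, vQ, vQ'] <;> field_simp <;>
    simp only [pzNA, pzNB, pzNC, pzXA, pzXB, pzdA, pzdB, pzS, pzY, pzE] <;> ring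

set_option maxHeartbeats 1000000 in
theorem pz_Q'Q {i j : ℝ} (hS : pzS i j ≠ 0) (hY : pzY i j ≠ 0) :
    vm i j (vQ' i j) (vQ i j) = ⟨j*pzE i j*(1+j)^2*pzS i j/pzY i j,0,0,0⟩ := by
  ext <;> simp only [vm, V4.mul, pzca, pzcb, pzc, vQ, vQ'] <;> field_simp <;>
    simp only [pzNA, pzNB, pzNC, pzXA, pzXB, pzdA, pzdB, pzS, pzY, pzE] <;> ring

set_option maxHeartbeats 1000000 in
theorem pz_BPB {i j : ℝ} (hS : pzS i j ≠ 0) (hY : pzY i j ≠ 0) :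
    vm i j vB (vm i j (vP i j) vB) = vBPB i j := by
  ext <;> simp only [vm, V4.mul, pzca, pzcb, pzc, vB, vP, vBPB] <;> field_simp <;>
    simp only [pzNA, pzNB, pzNC, pzXA, pzXB, pzdA, pzdB, pzS, pzY, pzE] <;> ring

set_option maxHeartbeats 1000000 in
theorem pz_PAi {i j : ℝ} (hS : pzS i j ≠ 0) (hY : pzY i j ≠ 0) :
    vm i j (vP i j) (vAi i j) = vPAi i j := by
  ext <;> simp only [vm, V4.mul, pzca, pzcb, pzc, vAi, vP, vPAi] <;> field_simp <;>
    simp only [pzNA, pzNB, pzNC, pzXA, pzXB, pzdA, pzdB, pzS, pzY, pzE] <;> ring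

set_option maxHeartbeats 1000000 in
theorem pz_I {i j : ℝ} (hS : pzS i j ≠ 0) (hY : pzY i j ≠ 0) :
    vm i j (vR i j) (vBPB i j) = vm i j (vPAi i j) (vR' i j) := by
  ext <;> simp only [vm, V4.mul, pzca, pzcb, pzc, vR, vBPB, vPAi, vR'] <;> field_simp <;>
    simp only [pzNA, pzNB, pzNC, pzXA, pzXB, pzdA, pzdB, pzS, pzY, pzE] <;> ring

set_option maxHeartbeats 1000000 in
theorem pz_AQA {i j : ℝ} (hS : pzS i j ≠ 0) (hY : pzY i j ≠ 0) :
    vm i j vA (vm i j (vQ i j) vA) = vAQA i j := by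
  ext <;> simp only [vm, V4.mul, pzca, pzcb, pzc, vA, vQ, vAQA] <;> field_simp <;>
    simp only [pzNA, pzNB, pzNC, pzXA, pzXB, pzdA, pzdB, pzS, pzY, pzE] <;> ring

set_option maxHeartbeats 1000000 in
theorem pz_BiQ {i j : ℝ} (hS : pzS i j ≠ 0) (hY : pzY i j ≠ 0) :
    vm i j (vBi i j) (vQ i j) = vBiQ i j := by
  ext <;> simp only [vm, V4.mul, pzca, pzcb, pzc, vBi, vQ, vBiQ] <;> field_simp <;>
    simp only [pzNA, pzNB, pzNC, pzXA, pzXB, pzdA, pzdB, pzS, pzY, pzE] <;> ring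

set_option maxHeartbeats 1000000 in
theorem pz_II {i j : ℝ} (hS : pzS i j ≠ 0) (hY : pzY i j ≠ 0) :
    vm i j (vR i j) (vAQA i j) = vm i j (vBiQ i j) (vR' i j) := by
  ext <;> simp only [vm, V4.mul, pzca, pzcb, pzc, vR, vAQA, vBiQ, vR'] <;> field_simp <;>
    simp only [pzNA, pzNB, pzNC, pzXA, pzXB, pzdA, pzdB, pzS, pzY, pzE] <;> ring

set_option maxHeartbeats 1000000 in
theorem pz_PW {i j : ℝ} (hS : pzS i j ≠ 0) (hY : pzY i j ≠ 0) :
    vm i j ⟨1+i,0,0,0⟩ (vm i j (vP i j) (vW i j)) = vm i j (vR i j) (vP' i j) := by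
  ext <;> simp only [vm, V4.mul, pzca, pzcb, pzc, vP, vW, vR, vP'] <;> field_simp <;>
    simp only [pzNA, pzNB, pzNC, pzXA, pzXB, pzdA, pzdB, pzS, pzY, pzE] <;> ring

set_option maxHeartbeats 1000000 in
theorem pz_QA {i j : ℝ} (hS : pzS i j ≠ 0) (hY : pzY i j ≠ 0) :
    vm i j ⟨1+j,0,0,0⟩ (vm i j (vQ i j) vA) = vm i j (vW i j) (vQ' i j) := by
  ext <;> simp only [vm, V4.mul, pzca, pzcb, pzc, vQ, vA, vW, vQ'] <;> field_simp <;>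
    simp only [pzNA, pzNB, pzNC, pzXA, pzXB, pzdA, pzdB, pzS, pzY, pzE] <;> ring

set_option maxHeartbeats 1000000 in
theorem pz_tr {i j : ℝ} (hS : pzS i j ≠ 0) (hY : pzY i j ≠ 0) :
    vm i j (vAi i j) (vm i j (vR' i j) (vBi i j)) =
      ⟨-((1+i)*(1+j))^2/pzS i j - (vm i j vB (vm i j (vR i j) vA)).a0, -(vm i j vB (vm i j (vR i j) vA)).a1,
        -(vm i j vB (vm i j (vR i j) vA)).a2, -(vm i j vB (vm i j (vR i j) vA)).a3⟩ := by
  ext <;> simp only [vm, V4.mul, pzca, pzcb, pzc, vR, vAi, vR', vBi, vA, vB] <;> field_simp <;>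
    simp only [pzNA, pzNB, pzNC, pzXA, pzXB, pzdA, pzdB, pzS, pzY, pzE] <;> ring


theorem pz_group' {G : Type*} [Group G] (A B r : G) (a b : ℕ)
    (hr : r = A ^ a * B ^ b * A * B ^ b * A ^ a)
    (h1 : r * (B * (A ^ a * B)) * r = A ^ a * A⁻¹)
    (h2 : r * (A * (B ^ b * A)) * r = B⁻¹ * B ^ b) :
    let x := B * r * A
    let z := A * x⁻¹
    let y := B * x⁻¹
    (z * x) ^ a * z * ((z*x) ^ a)⁻¹ = ((y*x) ^ (b+1))⁻¹ * y * (y*x) ^ (b+1) ∧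
    (y * z⁻¹)⁻¹ * y * (y * z⁻¹) = ((y*x)^b)⁻¹ * x * (y*x)^b ∧
    (y * z⁻¹)⁻¹ * z * (y * z⁻¹) = (z*x)^(a+1) * x * ((z*x)^(a+1))⁻¹ ∧
    x * ((y*x)^b * (y * z⁻¹)⁻¹ * (y*x)^(b+1) * (z*x)^a * (y * z⁻¹) * (z*x)^(a+1)) = 1 := by
  intro x
  have e1 : (A * r * B) * A ^ a * x = A ^ (a+1) := by
    calc (A * r * B) * A ^ a * x = A * (r * (B * (A ^ a * B)) * r) * A := by
          simp only [x, mul_assoc]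
      _ = A ^ (a+1) := by rw [h1, pow_succ']; simp [mul_assoc]
  have e2 : x * B ^ b * (A * r * B) = B ^ (b+1) := by
    calc x * B ^ b * (A * r * B) = B * (r * (A * (B ^ b * A)) * r) * B := by
          simp only [x, mul_assoc]
      _ = B ^ (b+1) := by rw [h2, pow_succ]; simp [mul_assoc]
  refine pz_group A B x (A * r * B) a b e1 e2 (by simp [x, mul_assoc]) ?_
  have e3 : B ^ b * A * B ^ b * A ^ a * B * A ^ a * x = 1 := by
    have h : A * A ^ a * (B ^ b * A * B ^ b * A ^ a * B * A ^ a * x) = A ^ (a+1) := by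
      rw [← e1]; nth_rw 1 [hr]; simp only [mul_assoc]
    rw [← pow_succ'] at h
    simpa using h
  have e4 := eq_inv_of_mul_eq_one_left e3
  calc x * B ^ b * A * B ^ b * A ^ a * B * A ^ a
      = x * (B ^ b * A * B ^ b * A ^ a * B * A ^ a) := by simp only [mul_assoc]
    _ = 1 := by rw [e4]; simp

theorem pz_norm_factor (A P P' : ℍ[ℝ]) (n : ℕ) (N k : ℝ) (hA : A * star A = 1)
    (hP : P' = star P) (hPP : P * P' = k • 1) (h : A ^ n = N • P) : N * N * k = 1 := by
  have e1 : Quaternion.normSq A = 1 := by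
    have := Quaternion.self_mul_star A
    rw [hA] at this
    have h2 : (1:ℍ[ℝ]).re = ((Quaternion.normSq A : ℝ) : ℍ[ℝ]).re := by rw [this]
    simpa using h2.symm
  have e2 : Quaternion.normSq P = k := by
    have := Quaternion.self_mul_star P
    rw [← hP, hPP] at this
    have h2 : (k • (1:ℍ[ℝ])).re = ((Quaternion.normSq P : ℝ) : ℍ[ℝ]).re := by rw [this]
    simpa using h2.symm
  have e3 : Quaternion.normSq (A ^ n) = 1 := by rw [map_pow, e1, one_pow]
  rw [h, Quaternion.normSq_smul, e2] at e3
  rw [← e3]; ring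


theorem pz_alg {i j : ℝ} (hi : 0 < i) (hj : 0 < j) (hS : 0 < pzS i j) (hY : 0 < pzY i j)
    (hE : 0 < pzE i j) (A B : ℍ[ℝ]) (hA : A * A = (2*pzca i j) • A - 1)
    (hB : B * B = (2*pzcb i j) • B - 1)
    (hBA : B * A = (2*pzcb i j) • A + (2*pzca i j) • B - (2*pzc i j) • 1 - A * B)
    (hsA : star A = (2*pzca i j) • 1 - A) (hsB : star B = (2*pzcb i j) • 1 - B)
    (a b : ℕ) (NA NB : ℝ) (hAa : A ^ a = NA • (vP i j).toH A B)
    (hBb : B ^ b = NB • (vQ i j).toH A B) :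
    let r := A ^ a * B ^ b * A * B ^ b * A ^ a
    let x := B * r * A
    A * star A = 1 ∧ B * star B = 1 ∧
    r * (B * (A ^ a * B)) * r = A ^ a * star A ∧
    r * (A * (B ^ b * A)) * r = star B * B ^ b ∧
    ∃ t : ℝ, t ≠ 0 ∧ x * (t • 1 - x) = 1  := by
  intro r x
  have hS' := hS.ne'
  have hY' := hY.ne'
  have hi1 : (1 + i) ≠ 0 := by positivity
  have hj1 : (1 + j) ≠ 0 := by positivity
  have hm := V4.toH_mul A B _ _ _ hA hB hBA
  have hAs : A * star A = 1 := by rw [hsA, mul_sub, hA]; simp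
  have hBs : B * star B = 1 := by rw [hsB, mul_sub, hB]; simp
  have hAs' : star A * A = 1 := by rw [hsA, sub_mul, hA]; simp
  have hBs' : star B * B = 1 := by rw [hsB, sub_mul, hB]; simp
  have tA : V4.toH A B vA = A := by simp [V4.toH, vA]
  have tB : V4.toH A B vB = B := by simp [V4.toH, vB]
  have tAi : V4.toH A B (vAi i j) = star A := by simp [V4.toH, vAi, hsA]; module
  have tBi : V4.toH A B (vBi i j) = star B := by simp [V4.toH, vBi, hsB]; module
  have tk (k : ℝ) : V4.toH A B ⟨k,0,0,0⟩ = k • 1 := by simp [V4.toH]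
  have lift {u v w : V4} (h : vm i j u v = w) : u.toH A B * v.toH A B = w.toH A B := by
    rw [← h]; exact (hm u v).symm
  have cN : pzNA i j / pzY i j = 2 * pzS i j * pzca i j := by
    unfold pzca; field_simp
  have cN' : pzNB i j / pzY i j = 2 * pzS i j * pzcb i j := by
    unfold pzcb; field_simp
  have st (t : ℝ) (u : ℍ[ℝ]) : star (t • u) = t • star u := Quaternion.star_smul t u
  have sP : (vP' i j).toH A B = star ((vP i j).toH A B) := by
    simp only [V4.toH, vP, vP', star_add, st, star_one, star_zero, star_trivial, hsA, cN, zero_smul]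
    module
  have sQ : (vQ' i j).toH A B = star ((vQ i j).toH A B) := by
    simp only [V4.toH, vQ, vQ', star_add, st, star_one, star_zero, star_trivial, hsB, cN', zero_smul]
    module
  have PP' := lift (pz_PP' hS' hY')
  have P'P := lift (pz_P'P hS' hY')
  have QQ' := lift (pz_QQ' hS' hY')
  have Q'Q := lift (pz_Q'Q hS' hY')
  have RR' := lift (pz_RR' hS' hY')
  have R'R := lift (pz_R'R hS' hY')
  have PAi := lift (pz_PAi hS' hY')
  have BiQ := lift (pz_BiQ hS' hY')
  have BPB : B * ((vP i j).toH A B * B) = (vBPB i j).toH A B := by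
    have := lift (pz_BPB hS' hY'); rw [← lift rfl, tB] at this; exact this
  have AQA : A * ((vQ i j).toH A B * A) = (vAQA i j).toH A B := by
    have := lift (pz_AQA hS' hY'); rw [← lift rfl, tA] at this; exact this
  have I1 := lift (pz_I hS' hY')
  rw [← lift rfl] at I1
  have I2 := lift (pz_II hS' hY')
  rw [← lift rfl] at I2
  have PW := lift (pz_PW hS' hY')
  rw [← lift rfl, ← lift rfl, tk] at PW
  have QA := lift (pz_QA hS' hY')
  rw [← lift rfl, ← lift rfl, tk, tA] at QA
  rw [tk] at PP' P'P QQ' Q'Q RR' R'R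
  rw [tAi] at PAi
  rw [tBi] at BiQ
  have nPA := pz_norm_factor A _ _ a NA _ hAs sP PP' hAa
  have nQB := pz_norm_factor B _ _ b NB _ hBs sQ QQ' hBb
  have TR : star A * ((vR' i j).toH A B * star B) =
      (-((1+i)*(1+j))^2/pzS i j) • 1 - B * ((vR i j).toH A B * A) := by
    have h1 := lift (pz_tr hS' hY')
    have h2 := lift (u := vB) (v := vm i j (vR i j) vA) rfl
    rw [← lift rfl, tA, tB] at h2
    rw [← lift rfl, tAi, tBi] at h1
    rw [h1, h2]
    simp only [V4.toH]
    module
  set P := (vP i j).toH A B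
  set Q := (vQ i j).toH A B
  set R := (vR i j).toH A B
  set R' := (vR' i j).toH A B
  set W := (vW i j).toH A B
  set nA := i*pzE i j*(1+i)^2*pzS i j/pzY i j
  set nB := j*pzE i j*(1+j)^2*pzS i j/pzY i j
  set k := (1+i)*(1+j) with hk
  have hk0 : k ≠ 0 := mul_ne_zero hi1 hj1
  have QAQ : (1+j) • (Q * A * Q) = nB • W := by
    have := congrArg (· * Q) QA
    simp only [mul_assoc, Q'Q] at this
    simpa [mul_assoc] using this
  have PWP : (1+i) • (P * W * P) = nA • R := by
    have := congrArg (· * P) PW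
    simp only [mul_assoc, P'P] at this
    simpa [mul_assoc] using this
  have kr : k • (P * Q * A * Q * P) = (nA * nB) • R := by
    calc k • (P * Q * A * Q * P) = (1+i) • (P * ((1+j) • (Q * A * Q)) * P) := by
          simp only [hk, mul_smul_comm, smul_mul_assoc, smul_smul, mul_assoc]
      _ = nB • ((1+i) • (P * W * P)) := by
          rw [QAQ]; simp only [mul_smul_comm, smul_mul_assoc, smul_smul, mul_comm]
      _ = (nA * nB) • R := by rw [PWP, smul_smul, mul_comm]
  have hr : r = k⁻¹ • R := by
    have e : r = (NA*NA*(NB*NB)) • (P * Q * A * Q * P) := by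
      simp only [r, hAa, hBb, mul_smul_comm, smul_mul_assoc, smul_smul, mul_assoc]
      congr 1; ring
    have e2 : k • r = R := by
      rw [e, smul_comm, kr, smul_smul]
      have : NA*NA*(NB*NB) * (nA*nB) = 1 := by
        calc _ = (NA*NA*nA)*(NB*NB*nB) := by ring
          _ = 1 := by rw [nPA, nQB, one_mul]
      rw [this, one_smul]
    rw [← e2, smul_smul, inv_mul_cancel₀ hk0, one_smul]
  refine ⟨hAs, hBs, ?_, ?_, -k/pzS i j, ?_, ?_⟩
  · calc r * (B * (A ^ a * B)) * r = (k⁻¹ * k⁻¹ * NA) • ((R * (B * (P * B))) * R) := by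
          rw [hr, hAa]
          simp only [mul_smul_comm, smul_mul_assoc, smul_smul]
          congr 1; ring
      _ = A ^ a * star A := by
          rw [BPB, I1, mul_assoc _ R' R, R'R, ← PAi, hAa]
          simp only [mul_smul_comm, smul_mul_assoc, smul_smul, mul_one]
          congr 1; field_simp
  · calc r * (A * (B ^ b * A)) * r = (k⁻¹ * k⁻¹ * NB) • ((R * (A * (Q * A))) * R) := by
          rw [hr, hBb]
          simp only [mul_smul_comm, smul_mul_assoc, smul_smul]
          congr 1; ring
      _ = star B * B ^ b := by
          rw [AQA, I2, mul_assoc _ R' R, R'R, ← BiQ, hBb]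
          simp only [mul_smul_comm, smul_mul_assoc, smul_smul, mul_one]
          congr 1; field_simp
  · exact div_ne_zero (neg_ne_zero.mpr hk0) hS'
  · have hx : x = k⁻¹ • (B * (R * A)) := by
      simp only [x, hr, mul_smul_comm, smul_mul_assoc, mul_assoc]
    have h2 : (-k/pzS i j) • (1:ℍ[ℝ]) - x = k⁻¹ • (star A * (R' * star B)) := by
      rw [TR, hx, smul_sub, smul_smul]
      congr 2; field_simp
    rw [h2, hx, smul_mul_smul_comm]
    have h3 : B * (R * A) * (star A * (R' * star B)) = k^2 • 1 := by
      calc B * (R * A) * (star A * (R' * star B)) = B * (R * (A * star A) * R') * star B := by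
            simp only [mul_assoc]
        _ = k^2 • 1 := by rw [hAs, mul_one, RR']; simp [hBs]
    rw [h3, smul_smul]
    have : k⁻¹ * k⁻¹ * k^2 = 1 := by field_simp
    rw [this, one_smul]


/-! ### Finite groups of quaternions -/

theorem pz_cross {u a : ℍ[ℝ]} (h : u * a = a * u) :
    u.imJ * a.imK = u.imK * a.imJ ∧ u.imK * a.imI = u.imI * a.imK ∧
    u.imI * a.imJ = u.imJ * a.imI := by
  have h1 := congrArg QuaternionAlgebra.imI h
  have h2 := congrArg QuaternionAlgebra.imJ h
  have h3 := congrArg QuaternionAlgebra.imK h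
  simp only [Quaternion.imI_mul, Quaternion.imJ_mul, Quaternion.imK_mul] at h1 h2 h3
  refine ⟨by linarith, by linarith, by linarith⟩

theorem pz_comm_of_cross {u a : ℍ[ℝ]} (h1 : u.imJ * a.imK = u.imK * a.imJ)
    (h2 : u.imK * a.imI = u.imI * a.imK) (h3 : u.imI * a.imJ = u.imJ * a.imI) :
    u * a = a * u := by
  ext
  · simp only [Quaternion.re_mul]; ring
  · simp only [Quaternion.imI_mul]; linarith
  · simp only [Quaternion.imJ_mul]; linarith
  · simp only [Quaternion.imK_mul]; linarith

theorem pz_centralizer {u v a : ℍ[ℝ]} (ha : ¬ (a.imI = 0 ∧ a.imJ = 0 ∧ a.imK = 0))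
    (hu : u * a = a * u) (hv : v * a = a * v) : u * v = v * u := by
  obtain ⟨u1, u2, u3⟩ := pz_cross hu
  obtain ⟨v1, v2, v3⟩ := pz_cross hv
  by_cases h1 : a.imI = 0
  · by_cases h2 : a.imJ = 0
    · have h3 : a.imK ≠ 0 := fun h => ha ⟨h1, h2, h⟩
      simp only [h1, h2, mul_zero, mul_eq_zero, h3, or_false, zero_eq_mul] at u1 u2 v1 v2
      exact pz_comm_of_cross (by simp [u1, v1]) (by simp [u2, v2]) (by simp [u1, v1])
    · simp only [h1, mul_zero, mul_eq_zero, h2, or_false, zero_eq_mul] at u3 v3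
      refine pz_comm_of_cross ?_ (by simp [u3, v3]) (by simp [u3, v3])
      apply mul_right_cancel₀ h2
      linear_combination u.imJ * (-v1) + v.imJ * u1
  · have h' : u.imK * v.imI = u.imI * v.imK := by
      apply mul_right_cancel₀ h1
      linear_combination u2 * v.imI - v2 * u.imI
    refine pz_comm_of_cross ?_ h' ?_ <;> apply mul_right_cancel₀ h1
    · linear_combination (-v.imK) * u3 + u.imK * v3 - a.imJ * h'
    · linear_combination u3 * v.imI - v3 * u.imI

theorem pz_finite {G : Type*} [Group G] [Finite G] (φ : G →* ℍ[ℝ]ˣ) (x y z g h : G)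
    (hy : y = g * x * g⁻¹) (hz : z = h * x * h⁻¹) (t : ℝ) (ht : t ≠ 0)
    (hx : (φ x : ℍ[ℝ]) * (t • 1 - (φ x : ℍ[ℝ])) = 1)
    (hB1 : φ (y * x) ≠ 1) (hB2 : ‖(1:ℍ[ℝ]) - (φ (y * x) : ℍ[ℝ])‖ < 1/2) :
    (φ (z * x) : ℍ[ℝ]) * (φ (y * x) : ℍ[ℝ]) = φ (y * x) * φ (z * x) := by
  have hnorm (k : G) : ‖(φ k : ℍ[ℝ])‖ = 1 := by
    obtain ⟨n, hn, hk⟩ := isOfFinOrder_iff_pow_eq_one.mp (isOfFinOrder_of_finite k)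
    have e : (φ k : ℍ[ℝ]) ^ n = 1 := by
      rw [← Units.val_pow_eq_pow_val, ← map_pow, hk]; simp
    have e2 : ‖(φ k : ℍ[ℝ])‖ ^ n = 1 := by rw [← norm_pow, e, norm_one]
    exact (pow_eq_one_iff_of_nonneg (norm_nonneg _) hn.ne').mp e2
  obtain ⟨g0, hg0, hmin⟩ := Set.exists_min_image {k : G | φ k ≠ 1}
    (fun k => ‖(1:ℍ[ℝ]) - (φ k : ℍ[ℝ])‖) (Set.toFinite _) ⟨y * x, hB1⟩
  set a : ℍ[ℝ] := (φ g0 : ℍ[ℝ]) with ha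
  have hδ : ‖1 - a‖ < 1/2 := lt_of_le_of_lt (hmin _ hB1) hB2
  have ha1 : a ≠ 1 := fun h => hg0 (Units.ext h)
  have hδ0 : 0 < ‖1 - a‖ := norm_pos_iff.mpr (sub_ne_zero.mpr ha1.symm)
  have cancel (k : G) : (φ k⁻¹ : ℍ[ℝ]) * (φ k : ℍ[ℝ]) = 1 := by
    rw [← Units.val_mul, ← map_mul]; simp
  have cancel' (k : G) : (φ k : ℍ[ℝ]) * (φ k⁻¹ : ℍ[ℝ]) = 1 := by
    rw [← Units.val_mul, ← map_mul]; simp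
  -- commutation of conjugates
  have hcomm (k : G) : (φ (k * g0 * k⁻¹) : ℍ[ℝ]) * a = a * φ (k * g0 * k⁻¹) := by
    set b : ℍ[ℝ] := (φ (k * g0 * k⁻¹) : ℍ[ℝ]) with hb
    have hbe : b = φ k * a * φ k⁻¹ := by simp [hb, ha]
    have hb1 : ‖1 - b‖ = ‖1 - a‖ := by
      have : 1 - b = φ k * (1 - a) * φ k⁻¹ := by
        rw [hbe, mul_sub, sub_mul, mul_one, cancel']
      rw [this, norm_mul, norm_mul, hnorm, hnorm]; ring
    set cc := g0 * (k * g0 * k⁻¹) * (g0⁻¹ * (k * g0 * k⁻¹)⁻¹) with hcc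
    have hc1 : (1 - (φ cc : ℍ[ℝ])) * (b * a) = b * a - a * b := by
      have : (φ cc : ℍ[ℝ]) * (b * a) = a * b := by
        have : cc * ((k * g0 * k⁻¹) * g0) = g0 * (k * g0 * k⁻¹) := by
          rw [hcc]; group
        have := congrArg (fun w => (φ w : ℍ[ℝ])) this
        simpa only [map_mul, Units.val_mul, ← ha, hb] using this
      rw [sub_mul, this, one_mul]
    have hlt : ‖1 - (φ cc : ℍ[ℝ])‖ < ‖1 - a‖ := by
      have e1 : ‖1 - (φ cc : ℍ[ℝ])‖ = ‖b * a - a * b‖ := by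
        rw [← hc1, norm_mul, norm_mul, hnorm, hnorm]; ring
      have e2 : b * a - a * b = (1 - b) * (1 - a) - (1 - a) * (1 - b) := by noncomm_ring
      calc ‖1 - (φ cc : ℍ[ℝ])‖ ≤ ‖(1 - b) * (1 - a)‖ + ‖(1 - a) * (1 - b)‖ := by
            rw [e1, e2]; exact norm_sub_le _ _
        _ = 2 * ‖1 - a‖ * ‖1 - a‖ := by rw [norm_mul, norm_mul, hb1]; ring
        _ < ‖1 - a‖ := by nlinarith
    have hcc1 : φ cc = 1 := by
      by_contra hne
      exact absurd (hmin cc hne) (not_le.mpr hlt)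
    have : b * a - a * b = 0 := by rw [← hc1, hcc1]; simp
    exact sub_eq_zero.mp this
  have hsa : a * star a = 1 := by
    rw [Quaternion.self_mul_star, Quaternion.normSq_eq_norm_mul_self, ha, hnorm]; simp
  have hst : star a = (2 * a.re) • 1 - a := by
    rw [Quaternion.star_eq_two_re_sub]
    simp [Algebra.smul_def]
  set τ := 2 * a.re with hτ
  have haa : a * a = τ • a - 1 := by
    rw [hst, mul_sub] at hsa
    rw [← hsa]; simp
  have hnr : ¬ (a.imI = 0 ∧ a.imJ = 0 ∧ a.imK = 0) := by
    rintro ⟨h1, h2, h3⟩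
    have har : a = (a.re : ℍ[ℝ]) := by
      ext <;> simp [h1, h2, h3]
    have hn := hnorm g0
    rw [← ha, har, Quaternion.norm_coe] at hn
    rcases eq_or_eq_neg_of_abs_eq hn with h | h
    · exact ha1 (by rw [har, h]; simp)
    · have : a = -1 := by rw [har, h]; simp
      rw [this] at hδ
      have : (1:ℍ[ℝ]) - -1 = ((2:ℝ) : ℍ[ℝ]) := by
        rw [sub_neg_eq_add, one_add_one_eq_two]; norm_cast
      rw [this, Quaternion.norm_coe] at hδ
      norm_num at hδ
  have hdich (k : G) : (φ (k * g0 * k⁻¹) : ℍ[ℝ]) = a ∨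
      (φ (k * g0 * k⁻¹) : ℍ[ℝ]) = τ • 1 - a := by
    have hc := hcomm k
    set b : ℍ[ℝ] := (φ (k * g0 * k⁻¹) : ℍ[ℝ]) with hb
    have hbe : b = φ k * a * φ k⁻¹ := by simp [hb, ha]
    have hbb : b * b = τ • b - 1 := by
      calc b * b = φ k * (a * ((φ k⁻¹ * φ k : ℍ[ℝ]) * a)) * φ k⁻¹ := by
            rw [hbe]; simp only [mul_assoc]
        _ = φ k * (a * a) * φ k⁻¹ := by rw [cancel, one_mul]
        _ = τ • b - 1 := by
          rw [haa, mul_sub, sub_mul, mul_one, cancel', hbe]; simp [mul_assoc]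
    have : (b - a) * (b - (τ • 1 - a)) = 0 := by
      have e : (b - a) * (b - (τ • 1 - a)) = b * b - τ • b + b * a - a * b + τ • a - a * a := by
        simp only [sub_mul, mul_sub, mul_smul_comm, mul_one, smul_sub]; abel
      rw [e, hbb, haa, hc]; abel
    rcases mul_eq_zero.mp this with h | h
    · exact Or.inl (sub_eq_zero.mp h)
    · exact Or.inr (sub_eq_zero.mp h)
  set X : ℍ[ℝ] := (φ x : ℍ[ℝ]) with hX
  have hXX : X * X = t • X - 1 := by
    rw [mul_sub] at hx
    rw [← hx]; simp
  have hXa : X * a = a * X := by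
    have e : X * a = (φ (x * g0 * x⁻¹) : ℍ[ℝ]) * X := by
      simp only [map_mul, Units.val_mul, ← hX, ← ha]
      rw [mul_assoc, mul_assoc, cancel, mul_one]
    rcases hdich x with h | h
    · rw [e, h]
    · rw [h] at e
      have e1 : X * X * a = a * (X * X) := by
        rw [mul_assoc, e, ← mul_assoc, mul_sub, sub_mul, e]
        simp only [mul_smul_comm, smul_mul_assoc, mul_one, sub_mul, one_mul, mul_assoc]
        abel
      rw [hXX, sub_mul, mul_sub, one_mul, mul_one, sub_left_inj, smul_mul_assoc, mul_smul_comm] at e1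
      exact smul_right_injective _ ht e1
  have hconj (w k : G) (hw : w = k * x * k⁻¹) : (φ w : ℍ[ℝ]) * a = a * φ w := by
    have e : X * (φ (k⁻¹ * g0 * k⁻¹⁻¹) : ℍ[ℝ]) = (φ (k⁻¹ * g0 * k⁻¹⁻¹) : ℍ[ℝ]) * X := by
      rcases hdich k⁻¹ with h | h
      · rw [h, hXa]
      · rw [h, mul_sub, sub_mul, hXa]; simp
    have e2 : w * g0 = k * (x * (k⁻¹ * g0 * k⁻¹⁻¹)) * k⁻¹ := by rw [hw]; group
    have e3 : g0 * w = k * ((k⁻¹ * g0 * k⁻¹⁻¹) * x) * k⁻¹ := by rw [hw]; group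
    have e4 : (φ (w * g0) : ℍ[ℝ]) = φ (g0 * w) := by
      rw [e2, e3, map_mul, map_mul, map_mul φ _ k⁻¹, map_mul φ k, map_mul φ x, map_mul φ _ x]
      simp only [Units.val_mul, ← hX]
      rw [e]
    simpa [ha] using e4
  have hYa := hconj y g hy
  have hZa := hconj z h hz
  apply pz_centralizer hnr
  · simp only [map_mul, Units.val_mul, ← hX]
    rw [mul_assoc, hXa, ← mul_assoc, hZa, mul_assoc]
  · simp only [map_mul, Units.val_mul, ← hX]
    rw [mul_assoc, hXa, ← mul_assoc, hYa, mul_assoc]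


/-! ### Realisation by unit quaternions -/

theorem pz_pow (A : ℍ[ℝ]) (α S d : ℝ) (hA : A * A = (2 * Real.cos α) • A - 1)
    (hs : Real.sin α ≠ 0) (hS : S ≠ 0) (a : ℕ)
    (h : S * Real.sin ((a + 1) * α) = d * Real.sin (a * α)) :
    ∃ N : ℝ, A ^ a = N • ((d - 2 * Real.cos α * S) • 1 + S • A) := by
  have key : ∀ n : ℕ, Real.sin α • A ^ n =
      Real.sin (n * α) • A - Real.sin ((n - 1) * α) • 1 := by
    intro n
    induction n with
    | zero => simp
    | succ n ih =>
      have e1 : Real.sin ((n+1) * α) = 2 * Real.cos α * Real.sin (n * α) - Real.sin ((n-1) * α) := by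
        have h1 : ((n:ℝ)+1) * α = n * α + α := by ring
        have h2 : ((n:ℝ)-1) * α = n * α - α := by ring
        rw [h1, h2, Real.sin_add, Real.sin_sub]; ring
      rw [pow_succ, ← smul_mul_assoc, ih, sub_mul, smul_mul_assoc, hA]
      push_cast
      rw [e1, add_sub_cancel_right]
      simp only [smul_mul_assoc, one_mul]
      module
  refine ⟨Real.sin (a * α) / (S * Real.sin α), ?_⟩
  have e2 : S * Real.sin ((a - 1) * α) = - ((d - 2 * Real.cos α * S) * Real.sin (a * α)) := by
    have h1 : ((a:ℝ)+1) * α = a * α + α := by ring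
    have h2 : ((a:ℝ)-1) * α = a * α - α := by ring
    rw [h1, Real.sin_add] at h
    rw [h2, Real.sin_sub]
    linear_combination -h
  have e3 : (S * Real.sin α) • A ^ a = Real.sin (a * α) • ((d - 2 * Real.cos α * S) • 1 + S • A) := by
    rw [mul_smul, key, smul_sub, smul_smul, smul_smul, e2]
    module
  rw [div_eq_inv_mul, mul_smul, ← e3, smul_smul, inv_mul_cancel₀ (mul_ne_zero hS hs), one_smul]

theorem pz_exists_AB (ca cb c : ℝ) (h1 : ca^2 < 1)
    (hD : 0 < 1 + 2*ca*cb*c - ca^2 - cb^2 - c^2) :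
    ∃ A B : ℍ[ℝ], A * A = (2*ca) • A - 1 ∧ B * B = (2*cb) • B - 1 ∧
      B * A = (2*cb) • A + (2*ca) • B - (2*c) • 1 - A * B ∧
      star A = (2*ca) • 1 - A ∧ star B = (2*cb) • 1 - B ∧ B.re = cb ∧ A * B ≠ B * A := by
  set D := 1 + 2*ca*cb*c - ca^2 - cb^2 - c^2 with hDd
  obtain ⟨s, hs0, hs⟩ : ∃ s : ℝ, 0 < s ∧ s * s = 1 - ca^2 :=
    ⟨√(1 - ca^2), Real.sqrt_pos.mpr (by linarith), Real.mul_self_sqrt (by linarith)⟩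
  obtain ⟨d, hd0, hd⟩ : ∃ d : ℝ, 0 < d ∧ d * d = D :=
    ⟨√D, Real.sqrt_pos.mpr hD, Real.mul_self_sqrt hD.le⟩
  have hs' := hs0.ne'
  obtain ⟨m, hm⟩ : ∃ m : ℝ, m = (c - ca*cb)/s := ⟨_, rfl⟩
  obtain ⟨n, hn⟩ : ∃ n : ℝ, n = d/s := ⟨_, rfl⟩
  have hms : m * s = c - ca * cb := by rw [hm]; field_simp
  have hn0 : 0 < n := by rw [hn]; positivity
  have hmn : m * m + n * n = 1 - cb^2 := by
    have : (m*m + n*n) * (s*s) = (1 - cb^2) * (s*s) := by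
      have h1 : n * s = d := by rw [hn]; field_simp
      calc (m*m + n*n) * (s*s) = (m*s)*(m*s) + (n*s)*(n*s) := by ring
        _ = (1 - cb^2) * (s*s) := by rw [hms, h1, hd, hs, hDd]; ring
    exact mul_right_cancel₀ (mul_ne_zero hs' hs') this
  obtain ⟨A, A0, A1, A2, A3⟩ : ∃ A : ℍ[ℝ], A.re = ca ∧ A.imI = s ∧ A.imJ = 0 ∧ A.imK = 0 :=
    ⟨⟨ca, s, 0, 0⟩, rfl, rfl, rfl, rfl⟩
  obtain ⟨B, B0, B1, B2, B3⟩ : ∃ B : ℍ[ℝ], B.re = cb ∧ B.imI = m ∧ B.imJ = n ∧ B.imK = 0 :=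
    ⟨⟨cb, m, n, 0⟩, rfl, rfl, rfl, rfl⟩
  refine ⟨A, B, ?_, ?_, ?_, ?_, ?_, B0, ?_⟩
  · ext <;> simp [A0, A1, A2, A3] <;> linarith
  · ext <;> simp [B0, B1, B2, B3] <;> linarith
  · ext <;> simp [A0, A1, A2, A3, B0, B1, B2, B3] <;> linarith
  · ext <;> simp [A0, A1, A2, A3] <;> linarith
  · ext <;> simp [B0, B1, B2, B3] <;> linarith
  · intro h
    have := congrArg QuaternionAlgebra.imK h
    simp [A0, A1, A2, A3, B0, B1, B2, B3] at this
    have : s * n = 0 := by linarith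
    exact (mul_pos hs0 hn0).ne' this

theorem pz_infinite_of_params (p q : ℤ) (a b : ℕ) (hp : p = 2 * a + 1) (hq : q = 2 * b + 1)
    (i j α β : ℝ) (hi : 0 < i) (hj : 0 < j) (hS : 0 < pzS i j) (hY : 0 < pzY i j)
    (hE : 0 < pzE i j) (hα : Real.cos α = pzca i j) (hβ : Real.cos β = pzcb i j)
    (hsα : Real.sin α ≠ 0) (hsβ : Real.sin β ≠ 0)
    (hA : pzS i j * Real.sin ((a + 1) * α) = pzdA i j * Real.sin (a * α))
    (hB : pzS i j * Real.sin ((b + 1) * β) = pzdB i j * Real.sin (b * β))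
    (hcb : 7/8 < pzcb i j)
    (hD : 0 < 1 + 2*pzca i j*pzcb i j*pzc i j - pzca i j^2 - pzcb i j^2 - pzc i j^2) :
    Infinite (PresentedGroup (pretzelRels p q (2 * (p + q) + 1))) := by
  have hca : pzca i j ^ 2 < 1 := by
    have := Real.sin_sq_add_cos_sq α
    rw [hα] at this
    have h2 : 0 < Real.sin α ^ 2 := by positivity
    linarith
  obtain ⟨A, B, hAA, hBB, hBA, hsA, hsB, hBre, hne⟩ := pz_exists_AB _ _ _ hca hD
  have cN : pzNA i j / pzY i j = 2 * pzca i j * pzS i j := by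
    have := hS.ne'
    have := hY.ne'
    unfold pzca; field_simp
  have cN' : pzNB i j / pzY i j = 2 * pzcb i j * pzS i j := by
    have := hS.ne'
    have := hY.ne'
    unfold pzcb; field_simp
  obtain ⟨NA, hNA⟩ := pz_pow A α _ _ (by rw [hα]; exact hAA) hsα hS.ne' a hA
  obtain ⟨NB, hNB⟩ := pz_pow B β _ _ (by rw [hβ]; exact hBB) hsβ hS.ne' b hB
  have hNA' : A ^ a = NA • (vP i j).toH A B := by
    rw [hNA, hα]; simp [V4.toH, vP, cN]
  have hNB' : B ^ b = NB • (vQ i j).toH A B := by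
    rw [hNB, hβ]; simp [V4.toH, vQ, cN']
  obtain ⟨eA, eB, e1, e2, t, ht, ex⟩ :=
    pz_alg hi hj hS hY hE A B hAA hBB hBA hsA hsB a b NA NB hNA' hNB'
  have eA' : star A * A = 1 := by rw [hsA, sub_mul, hAA]; simp
  have eB' : star B * B = 1 := by rw [hsB, sub_mul, hBB]; simp
  let uA : ℍ[ℝ]ˣ := ⟨A, star A, eA, eA'⟩
  let uB : ℍ[ℝ]ˣ := ⟨B, star B, eB, eB'⟩
  let r : ℍ[ℝ]ˣ := uA ^ a * uB ^ b * uA * uB ^ b * uA ^ a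
  obtain ⟨g1, g2, g3, g4⟩ := pz_group' uA uB r a b rfl (by
      apply Units.ext; simp only [r, Units.val_mul, Units.val_pow_eq_pow_val]; exact e1) (by
      apply Units.ext; simp only [r, Units.val_mul, Units.val_pow_eq_pow_val]; exact e2)
  set ux := uB * r * uA with hux
  set uz := uA * ux⁻¹ with huz
  set uy := uB * ux⁻¹ with huy
  have k1 : (p - 1) / 2 = a := by omega
  have k2 : (p + 1) / 2 = ((a + 1 : ℕ) : ℤ) := by push_cast; omega
  have k3 : (q - 1) / 2 = b := by omega
  have k4 : (q + 1) / 2 = ((b + 1 : ℕ) : ℤ) := by push_cast; omega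
  have hrel : ∀ w ∈ pretzelRels p q (2 * (p + q) + 1), FreeGroup.lift ![ux, uy, uz] w = 1 := by
    intro w hw
    simp only [pretzelRels, Set.mem_insert_iff, Set.mem_singleton_iff, k1, k2, k3, k4] at hw
    rcases hw with rfl | rfl | rfl | rfl
    · simp only [map_mul, map_inv, map_zpow, map_pow, FreeGroup.lift_apply_of, zpow_neg, zpow_natCast]
      rw [mul_inv_eq_one]
      exact g1
    · simp only [map_mul, map_inv, map_zpow, map_pow, FreeGroup.lift_apply_of, zpow_neg, zpow_natCast]
      rw [mul_inv_eq_one]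
      exact g2
    · simp only [map_mul, map_inv, map_zpow, map_pow, FreeGroup.lift_apply_of, zpow_neg, zpow_natCast]
      rw [mul_inv_eq_one]
      exact g3
    · simp only [map_mul, map_inv, map_zpow, map_pow, FreeGroup.lift_apply_of, zpow_natCast]
      simp only [← mul_assoc]
      rw [← zpow_add]
      have : 2 * (p + q) + 1 + -2 * (p + q) = 1 := by ring
      rw [this, zpow_one]
      simp only [← mul_assoc] at g4
      exact g4
  by_contra hinf
  have hfin : Finite (PresentedGroup (pretzelRels p q (2 * (p + q) + 1))) :=
    not_infinite_iff_finite.mp hinf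
  let φ := PresentedGroup.toGroup hrel
  let ofG (k : Fin 3) : PresentedGroup (pretzelRels p q (2 * (p + q) + 1)) := PresentedGroup.of k
  have f0 : φ (ofG 0) = ux := PresentedGroup.toGroup.of hrel
  have f1 : φ (ofG 1) = uy := PresentedGroup.toGroup.of hrel
  have f2 : φ (ofG 2) = uz := PresentedGroup.toGroup.of hrel
  have r2 : (ofG 1 * (ofG 2)⁻¹)⁻¹ * ofG 1 * (ofG 1 * (ofG 2)⁻¹) *
      ((ofG 1 * ofG 0) ^ (-((q - 1) / 2)) * ofG 0 * (ofG 1 * ofG 0) ^ ((q - 1) / 2))⁻¹ = 1 :=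
    PresentedGroup.one_of_mem (rels := pretzelRels p q (2 * (p + q) + 1)) (by
      simp only [pretzelRels]; right; left; rfl)
  have r3 : (ofG 1 * (ofG 2)⁻¹)⁻¹ * ofG 2 * (ofG 1 * (ofG 2)⁻¹) *
      ((ofG 2 * ofG 0) ^ ((p + 1) / 2) * ofG 0 * (ofG 2 * ofG 0) ^ (-((p + 1) / 2)))⁻¹ = 1 :=
    PresentedGroup.one_of_mem (rels := pretzelRels p q (2 * (p + q) + 1)) (by
      simp only [pretzelRels]; right; right; left; rfl)
  have fB : φ (ofG 1 * ofG 0) = uB := by rw [map_mul, f0, f1]; simp [uy]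
  have fA : φ (ofG 2 * ofG 0) = uA := by rw [map_mul, f0, f2]; simp [uz]
  apply hne
  have := pz_finite φ (ofG 0) (ofG 1) (ofG 2)
    ((ofG 1 * (ofG 2)⁻¹) * (ofG 1 * ofG 0) ^ (-((q - 1) / 2)))
    ((ofG 1 * (ofG 2)⁻¹) * (ofG 2 * ofG 0) ^ ((p + 1) / 2))
    (by
      rw [mul_inv_eq_one, mul_assoc, inv_mul_eq_iff_eq_mul, ← eq_mul_inv_iff_mul_eq] at r2
      nth_rw 1 [r2]; simp only [zpow_neg, mul_inv_rev, inv_inv, mul_assoc])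
    (by
      rw [mul_inv_eq_one, mul_assoc, inv_mul_eq_iff_eq_mul, ← eq_mul_inv_iff_mul_eq] at r3
      nth_rw 1 [r3]; simp only [zpow_neg, mul_inv_rev, inv_inv, mul_assoc]) t ht
    (by rw [f0]; simp only [hux, r, Units.val_mul, Units.val_pow_eq_pow_val]; exact ex)
    (by
      rw [fB]; intro h
      have hB1 : B = 1 := congrArg Units.val h
      exact hne (by rw [hB1]; simp))
    (by
      rw [fB]
      change ‖(1:ℍ[ℝ]) - B‖ < 1/2
      have h1 : ‖(1:ℍ[ℝ]) - B‖ * ‖(1:ℍ[ℝ]) - B‖ = 2 - 2 * pzcb i j := by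
        have hh : (1 - B) * star (1 - B) = (2 - 2 * pzcb i j) • (1:ℍ[ℝ]) := by
          rw [star_sub, star_one, sub_mul, mul_sub, mul_sub, eB, hsB]
          simp only [mul_one, one_mul]; module
        rw [← Quaternion.normSq_eq_norm_mul_self]
        rw [Quaternion.self_mul_star] at hh
        simpa using congrArg QuaternionAlgebra.re hh
      nlinarith [norm_nonneg ((1:ℍ[ℝ]) - B)])
  rw [fA, fB] at this
  exact this


/-! ### Analytic existence of parameters -/

theorem pz_ivt2 {a b c d : ℝ} (hab : a ≤ b) (hcd : c ≤ d) (G H : ℝ → ℝ → ℝ)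
    (hG1 : ∀ j ∈ Set.Icc c d, ContinuousOn (fun i => G i j) (Set.Icc a b))
    (hG2 : ∀ i ∈ Set.Icc a b, ContinuousOn (G i) (Set.Icc c d))
    (hmono : ∀ i ∈ Set.Icc a b, StrictMonoOn (G i) (Set.Icc c d))
    (hneg : ∀ i ∈ Set.Icc a b, G i c ≤ 0) (hpos : ∀ i ∈ Set.Icc a b, 0 ≤ G i d)
    (hH : ContinuousOn (fun z : ℝ × ℝ => H z.1 z.2) (Set.Icc a b ×ˢ Set.Icc c d))
    (hHa : ∀ j ∈ Set.Icc c d, 0 ≤ H a j) (hHb : ∀ j ∈ Set.Icc c d, H b j ≤ 0) :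
    ∃ i ∈ Set.Icc a b, ∃ j ∈ Set.Icc c d, G i j = 0 ∧ H i j = 0 := by
  have hex : ∀ i, ∃ j, i ∈ Set.Icc a b → j ∈ Set.Icc c d ∧ G i j = 0 := by
    intro i
    by_cases hi : i ∈ Set.Icc a b
    · obtain ⟨j, hj, hj2⟩ := intermediate_value_Icc hcd (hG2 i hi) ⟨hneg i hi, hpos i hi⟩
      exact ⟨j, fun _ => ⟨hj, hj2⟩⟩
    · exact ⟨0, fun h => absurd h hi⟩
  choose g hg using hex
  have hcont : ContinuousOn g (Set.Icc a b) := by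
    intro i0 hi0
    refine tendsto_order.2 ⟨fun l hl => ?_, fun l hl => ?_⟩
    · by_cases hlc : l < c
      · filter_upwards [self_mem_nhdsWithin] with i hi
        exact lt_of_lt_of_le hlc (hg i hi).1.1
      · have hlm : l ∈ Set.Icc c d := ⟨not_lt.mp hlc, hl.le.trans (hg i0 hi0).1.2⟩
        have h0 : G i0 l < 0 := by
          rw [← (hg i0 hi0).2]; exact hmono i0 hi0 hlm (hg i0 hi0).1 hl
        have := (hG1 l hlm i0 hi0).eventually (gt_mem_nhds h0)
        filter_upwards [self_mem_nhdsWithin, this] with i hi h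
        rw [← (hg i hi).2] at h
        exact ((hmono i hi).lt_iff_lt hlm (hg i hi).1).mp h
    · by_cases hlc : d < l
      · filter_upwards [self_mem_nhdsWithin] with i hi
        exact lt_of_le_of_lt (hg i hi).1.2 hlc
      · have hlm : l ∈ Set.Icc c d := ⟨(hg i0 hi0).1.1.trans hl.le, not_lt.mp hlc⟩
        have h0 : 0 < G i0 l := by
          rw [← (hg i0 hi0).2]; exact hmono i0 hi0 (hg i0 hi0).1 hlm hl
        have := (hG1 l hlm i0 hi0).eventually (lt_mem_nhds h0)
        filter_upwards [self_mem_nhdsWithin, this] with i hi h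
        rw [← (hg i hi).2] at h
        exact ((hmono i hi).lt_iff_lt (hg i hi).1 hlm).mp h
  have hF : ContinuousOn (fun i => H i (g i)) (Set.Icc a b) :=
    hH.comp (f := fun i => (i, g i)) (continuousOn_id.prodMk hcont)
      (fun i hi => ⟨hi, (hg i hi).1⟩)
  obtain ⟨i, hi, hi2⟩ := intermediate_value_Icc' hab hF
    ⟨hHb _ (hg b (Set.right_mem_Icc.mpr hab)).1, hHa _ (hg a (Set.left_mem_Icc.mpr hab)).1⟩
  exact ⟨i, hi, g i, (hg i hi).1, (hg i hi).2, hi2⟩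

def pzMA (i j : ℝ) : ℝ := j*(2-i*j)^2 + i + 3*(i*j) - (i*j)^2
def pzMB (i j : ℝ) : ℝ := i*(2-i*j)^2 + j + 3*(i*j) - (i*j)^2
noncomputable def pzτA (i j : ℝ) : ℝ := pzE i j * i * pzXA i j / ((1+i)^2 * pzMA i j)
noncomputable def pzτB (i j : ℝ) : ℝ := pzE i j * j * pzXB i j / ((1+j)^2 * pzMB i j)
noncomputable def pzSA (i j : ℝ) : ℝ := (2+i-i*j)^2 * pzXA i j / (i * pzE i j * pzMA i j)
noncomputable def pzTB (i j : ℝ) : ℝ := j * pzE i j * pzMB i j / ((2+j-i*j)^2 * pzXB i j)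

theorem pz_s_bd {i j : ℝ} (hi : i ∈ Set.Icc (1/5 : ℝ) 1) (hj : j ∈ Set.Icc (0 : ℝ) (1/36)) :
    0 ≤ i * j ∧ i * j ≤ j := 
  ⟨mul_nonneg (by linarith [hi.1]) hj.1, by nlinarith [hi.2, hj.1]⟩

theorem pz_S_pos {i j : ℝ} (hi : i ∈ Set.Icc (1/5 : ℝ) 1) (hj : j ∈ Set.Icc (0 : ℝ) (1/36)) :
    35/36 ≤ pzS i j := by
  have := pz_s_bd hi hj
  unfold pzS; linarith [hj.2]

theorem pz_E_pos {i j : ℝ} (hi : i ∈ Set.Icc (1/5 : ℝ) 1) (hj : j ∈ Set.Icc (0 : ℝ) (1/36)) :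
    3 ≤ pzE i j := by
  have := pz_s_bd hi hj
  unfold pzE; linarith [hi.1]

theorem pz_Y_pos {i j : ℝ} (hi : i ∈ Set.Icc (1/5 : ℝ) 1) (hj : j ∈ Set.Icc (0 : ℝ) (1/36)) :
    0 < pzY i j := by
  have := pz_s_bd hi hj
  have h2 := hj.2
  unfold pzY; nlinarith [hi.1, hj.1]

theorem pz_MA_ge {i j : ℝ} (hi : i ∈ Set.Icc (1/5 : ℝ) 1) (hj : j ∈ Set.Icc (0 : ℝ) (1/36)) :
    i ≤ pzMA i j := by
  have := pz_s_bd hi hj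
  have h2 := hj.2
  have h3 : 0 ≤ j * (2 - i*j)^2 := mul_nonneg hj.1 (sq_nonneg _)
  unfold pzMA; nlinarith [hi.1, hj.1]

theorem pz_MB_bd {i j : ℝ} (hi : i ∈ Set.Icc (1/5 : ℝ) 1) (hj : j ∈ Set.Icc (0 : ℝ) (1/36)) :
    15/4 * i ≤ pzMB i j ∧ pzMB i j ≤ 4 * i + j + 3 * (i * j) := by
  have h1 := pz_s_bd hi hj
  have h2 := hj.2
  have h3 : 15/4 ≤ (2 - i*j)^2 := by nlinarith
  have h3' : (2 - i*j)^2 ≤ 4 := by nlinarith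
  have hi0 : 0 ≤ i := by linarith [hi.1]
  have h4 := mul_le_mul_of_nonneg_left h3 hi0
  have h5 := mul_le_mul_of_nonneg_left h3' hi0
  unfold pzMB; constructor
  · nlinarith [hi.1, hj.1]
  · nlinarith [hi.1, hj.1, sq_nonneg (i*j)]

theorem pz_XB_bd {i j : ℝ} (hi : i ∈ Set.Icc (1/5 : ℝ) 1) (hj : j ∈ Set.Icc (0 : ℝ) (1/36)) :
    5/6 ≤ pzXB i j ∧ pzXB i j ≤ 1 := by
  have h1 := pz_s_bd hi hj
  have h2 := hj.2
  have h3 : i * (i*j) ≤ i*j := by nlinarith [hi.2]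
  have h4 : 0 ≤ i * (i*j) := mul_nonneg (by linarith [hi.1]) h1.1
  unfold pzXB; constructor
  · nlinarith [hi.1, hj.1]
  · nlinarith [hi.1, hj.1]

theorem pz_key_A {i j : ℝ} : pzE i j * i * pzXA i j + (1+i)^2 * pzMA i j = 4 * pzS i j * pzY i j := by
  unfold pzE pzXA pzMA pzS pzY; ring
theorem pz_key_B {i j : ℝ} : pzE i j * j * pzXB i j + (1+j)^2 * pzMB i j = 4 * pzS i j * pzY i j := by
  unfold pzE pzXB pzMB pzS pzY; ring

theorem pz_D_pos {i j : ℝ} (hi : 0 < i) (hj : 0 < j) (hS : 0 < pzS i j) (hY : 0 < pzY i j)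
    (hE : 0 < pzE i j) (hX : j * pzS i j < pzXA i j) :
    0 < 1 + 2*pzca i j*pzcb i j*pzc i j - pzca i j^2 - pzcb i j^2 - pzc i j^2 := by
  have h : 1 + 2*pzca i j*pzcb i j*pzc i j - pzca i j^2 - pzcb i j^2 - pzc i j^2 =
      pzE i j^2 * (pzXA i j - j * pzS i j) * (i*j) * ((1+i)*(1+j))^2 /
        (4 * pzY i j^2 * pzS i j^3) := by
    have := hS.ne'
    have := hY.ne'
    unfold pzca pzcb pzc
    field_simp
    simp only [pzNA, pzNB, pzNC, pzXA, pzXB, pzS, pzY, pzE]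
    ring
  rw [h]
  have : 0 < pzXA i j - j * pzS i j := by linarith
  positivity

set_option maxHeartbeats 1000000 in
theorem pz_TB_mono {i : ℝ} (hi : i ∈ Set.Icc (1/5 : ℝ) 1) :
    MonotoneOn (pzTB i) (Set.Icc (0 : ℝ) (1/36)) := by
  intro j1 h1 j2 h2 hle
  have hX1 := pz_XB_bd hi h1
  have hX2 := pz_XB_bd hi h2
  have hM1 := pz_MB_bd hi h1
  have hM2 := pz_MB_bd hi h2
  have hE1 := pz_E_pos hi h1
  have hE2 := pz_E_pos hi h2
  have hs1 := pz_s_bd hi h1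
  have hs2 := pz_s_bd hi h2
  obtain ⟨i1, i2⟩ := hi
  obtain ⟨a1, a2⟩ := h1
  obtain ⟨b1, b2⟩ := h2
  have hE : pzE i j1 ≤ pzE i j2 := by unfold pzE; nlinarith
  have hM : pzMB i j1 ≤ pzMB i j2 := by
    have e : pzMB i j2 - pzMB i j1 = (j2 - j1) * ((1-i) * (1 + 4*i - i^2*(j1+j2))) := by
      unfold pzMB; ring
    have : 0 ≤ (j2 - j1) * ((1-i) * (1 + 4*i - i^2*(j1+j2))) := by
      apply mul_nonneg (by linarith) (mul_nonneg (by linarith) _)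
      nlinarith
    linarith
  have hX : pzXB i j2 ≤ pzXB i j1 := by
    have e : pzXB i j1 - pzXB i j2 = (j2 - j1) * (1 + 4*i + i^2 - i^2*(j1+j2)) := by
      unfold pzXB; ring
    have : 0 ≤ (j2 - j1) * (1 + 4*i + i^2 - i^2*(j1+j2)) := by
      apply mul_nonneg (by linarith)
      nlinarith
    linarith
  have hq : j1 * (2 + j2 - i*j2)^2 ≤ j2 * (2 + j1 - i*j1)^2 := by
    have e : j2 * (2 + j1 - i*j1)^2 - j1 * (2 + j2 - i*j2)^2 = (j2 - j1) * (4 - (1-i)^2*(j1*j2)) := by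
      ring
    have : 0 ≤ (j2 - j1) * (4 - (1-i)^2*(j1*j2)) := by
      apply mul_nonneg (by linarith)
      have : j1 * j2 ≤ 1 := by nlinarith
      have : (1-i)^2 ≤ 1 := by nlinarith
      nlinarith [mul_nonneg a1 b1, sq_nonneg (1-i)]
    linarith
  unfold pzTB
  have p1 : 0 < (2 + j1 - i*j1) := by linarith
  have p2 : 0 < (2 + j2 - i*j2) := by linarith
  have x1 : 0 < pzXB i j1 := by linarith
  have x2 : 0 < pzXB i j2 := by linarith
  have m1 : 0 ≤ pzMB i j1 := by linarith
  have m2 : 0 ≤ pzMB i j2 := by linarith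
  rw [div_le_div_iff₀ (by positivity) (by positivity)]
  calc j1 * pzE i j1 * pzMB i j1 * ((2 + j2 - i*j2)^2 * pzXB i j2)
      = (j1 * (2 + j2 - i*j2)^2) * (pzE i j1 * pzMB i j1 * pzXB i j2) := by ring
    _ ≤ (j2 * (2 + j1 - i*j1)^2) * (pzE i j2 * pzMB i j2 * pzXB i j1) := by
        refine mul_le_mul hq ?_ (by positivity) (by positivity)
        refine mul_le_mul ?_ hX x2.le (mul_nonneg (by linarith) m2)
        exact mul_le_mul hE hM m1 (by linarith)
    _ = _ := by ring

theorem pz_τB_mono {i : ℝ} (hi : i ∈ Set.Icc (1/5 : ℝ) 1) :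
    StrictMonoOn (pzτB i) (Set.Icc (0 : ℝ) (1/36)) := by
  intro j1 h1 j2 h2 hlt
  have hX1 := pz_XB_bd hi h1
  have hX2 := pz_XB_bd hi h2
  have hM1 := pz_MB_bd hi h1
  have hM2 := pz_MB_bd hi h2
  have hE1 := pz_E_pos hi h1
  have hE2 := pz_E_pos hi h2
  have hs1 := pz_s_bd hi h1
  have hs2 := pz_s_bd hi h2
  obtain ⟨i1, i2⟩ := hi
  obtain ⟨a1, a2⟩ := h1
  obtain ⟨b1, b2⟩ := h2
  have hE : pzE i j1 ≤ pzE i j2 := by unfold pzE; nlinarith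
  have hii : 0 ≤ i^2*(j1+j2) ∧ i^2 * (j1+j2) ≤ 1/18 := by constructor <;> nlinarith [sq_nonneg i]
  obtain ⟨μ, hμ⟩ : ∃ μ, μ = (1-i) * (1 + 4*i - i^2*(j1+j2)) := ⟨_, rfl⟩
  have hμ1 : μ ≤ 25/16 := by
    have : μ ≤ (1-i)*(1+4*i) := by rw [hμ]; exact mul_le_mul_of_nonneg_left (by linarith [hii.1]) (by linarith)
    have h3 := sq_nonneg (i - 3/8)
    have h4 : (1-i)*(1+4*i) = 25/16 - 4*(i-3/8)^2 := by ring
    linarith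
  obtain ⟨ξ, hξ⟩ : ∃ ξ, ξ = 1 + 4*i + i^2 - i^2*(j1+j2) := ⟨_, rfl⟩
  have hξ1 : ξ ≤ 6 := by 
    have : i^2 ≤ 1 := pow_le_one₀ (by linarith) i2
    rw [hξ]; linarith [hii.1]
  have eM : pzMB i j2 - pzMB i j1 = (j2 - j1) * μ := by
    rw [hμ]; unfold pzMB; ring
  have eX : pzXB i j1 - pzXB i j2 = (j2 - j1) * ξ := by
    rw [hξ]; unfold pzXB; ring
  set X1 := pzXB i j1
  set X2 := pzXB i j2
  set M1 := pzMB i j1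
  set M2 := pzMB i j2
  have m1 : 0 < M1 := by linarith
  have m2 : 0 < M2 := by linarith
  have hM2' : M2 ≤ 4 * i + 1/36 + 1/12 * i := by
    have := mul_le_mul_of_nonneg_left b2 (show 0 ≤ i by linarith)
    linarith [hM2.2]
  have main : 0 < X1 * ((1+j1)^2*M1) - j2 * ξ * ((1+j1)^2*M1) -
      j1 * X1 * ((2+j1+j2)*M2 + (1+j1)^2*μ) := by
    have g1 : j2 * ξ ≤ 1/6 := by
      have := mul_le_mul_of_nonneg_left hξ1 b1
      linarith
    have g2 : (1+j1)^2 ≤ 1.06 := by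
      have := pow_le_pow_left₀ (by linarith : 0 ≤ 1+j1) (by linarith : 1+j1 ≤ 37/36) 2
      norm_num at this ⊢; linarith
    have g3 : 1 ≤ (1+j1)^2 := one_le_pow₀ (by linarith)
    have g4 : (2+j1+j2) * M2 ≤ 2.06 * M2 := mul_le_mul_of_nonneg_right (by norm_num; linarith) m2.le
    have g5 : (1+j1)^2*μ ≤ 2 := by
      by_cases h : 0 ≤ μ
      · have := mul_le_mul_of_nonneg_right g2 h
        norm_num at this; linarith
      · have := mul_nonpos_of_nonneg_of_nonpos (sq_nonneg (1+j1)) (not_le.mp h).le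
        linarith
    have g6 : (2+j1+j2)*M2 + (1+j1)^2*μ ≤ 9 * i + 2.1 := by norm_num at g4 ⊢; linarith
    have g7 : j1 * X1 * ((2+j1+j2)*M2 + (1+j1)^2*μ) ≤ 1/36 * (9*i+2.1) := by
      have : 0 ≤ j1 * X1 := mul_nonneg a1 (by linarith)
      have h36 : j1 * X1 ≤ 1/36 := by
        have := mul_le_mul a2 hX1.2 (by linarith) (by norm_num)
        linarith
      calc _ ≤ j1 * X1 * (9*i+2.1) := mul_le_mul_of_nonneg_left g6 this
        _ ≤ _ := mul_le_mul_of_nonneg_right h36 (by norm_num; linarith)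
    have g8 : 2/3 * (15/4*i) ≤ (X1 - j2*ξ) * ((1+j1)^2*M1) := by
      apply mul_le_mul (by linarith) _ (by linarith) (by linarith)
      have := le_mul_of_one_le_left m1.le g3
      linarith
    have g9 : (X1 - j2*ξ) * ((1+j1)^2*M1) = X1 * ((1+j1)^2*M1) - j2 * ξ * ((1+j1)^2*M1) := by ring
    norm_num at g7 ⊢
    linarith
  have n1 : j1 * X1 * ((1+j2)^2 * M2) < j2 * X2 * ((1+j1)^2 * M1) := by
    have hX2 : X2 = X1 - (j2-j1)*ξ := by linarith
    have hM1e : (1+j2)^2*M2 = (1+j1)^2*M1 + (j2-j1)*((2+j1+j2)*M2 + (1+j1)^2*μ) := by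
      have : M1 = M2 - (j2-j1)*μ := by linarith
      rw [this]; ring
    have : j2 * X2 * ((1+j1)^2 * M1) - j1 * X1 * ((1+j2)^2 * M2) = (j2-j1) * (X1 * ((1+j1)^2*M1) - j2 * ξ * ((1+j1)^2*M1) -
      j1 * X1 * ((2+j1+j2)*M2 + (1+j1)^2*μ)) := by
      rw [hM1e, hX2]; ring
    have h3 := mul_pos (sub_pos.mpr hlt) main
    linarith
  unfold pzτB
  rw [div_lt_div_iff₀ (by positivity) (by positivity)]
  calc pzE i j1 * j1 * X1 * ((1+j2)^2*M2) = pzE i j1 * (j1 * X1 * ((1+j2)^2 * M2)) := by ring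
    _ ≤ pzE i j2 * (j1 * X1 * ((1+j2)^2 * M2)) := by
      apply mul_le_mul_of_nonneg_right hE
      have : 0 ≤ X1 := by linarith
      positivity
    _ < pzE i j2 * (j2 * X2 * ((1+j1)^2 * M1)) := mul_lt_mul_of_pos_left n1 (by linarith)
    _ = _ := by ring


theorem pz_τB_end {i : ℝ} (hi : i ∈ Set.Icc (1/5 : ℝ) 1) : 43/2000 ≤ pzτB i (1/36) := by
  have hj : (1/36 : ℝ) ∈ Set.Icc (0 : ℝ) (1/36) := by constructor <;> norm_num
  have hM := pz_MB_bd hi hj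
  obtain ⟨i1, i2⟩ := hi
  have : 0 < pzMB i (1/36) := by linarith
  unfold pzτB
  rw [le_div_iff₀ (by positivity)]
  unfold pzE pzXB pzMB
  have h2 : 0 ≤ (1 - i) * (i - 1/5) := mul_nonneg (by linarith) (by linarith)
  nlinarith [mul_nonneg h2 (by linarith : 0 ≤ i)]

theorem pz_τA_start {j : ℝ} (hj : j ∈ Set.Icc (0 : ℝ) (1/36)) : 1 ≤ pzτA (1/5) j := by
  have hi : (1/5 : ℝ) ∈ Set.Icc (1/5 : ℝ) 1 := by constructor <;> norm_num
  have hM := pz_MA_ge hi hj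
  obtain ⟨i1, i2⟩ := hj
  have : 0 < pzMA (1/5) j := by linarith
  unfold pzτA
  rw [le_div_iff₀ (by positivity)]
  unfold pzE pzXA pzMA
  have h2 : 0 ≤ j * (1/36 - j) := mul_nonneg (by linarith) (by linarith)
  nlinarith [mul_nonneg h2 i1, mul_nonneg (mul_nonneg i1 i1) i1]

theorem pz_arctan_ge {t : ℝ} (ht : 43/2000 ≤ t) : Real.pi / 22 ≤ Real.arctan (√t) := by
  have hp := Real.pi_lt_d4
  have hp0 := Real.pi_pos
  obtain ⟨x, hx⟩ : ∃ x, x = Real.pi / 22 := ⟨_, rfl⟩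
  have hx0 : 0 < x := by rw [hx]; positivity
  have hx1 : x ≤ 1429/10000 := by rw [hx]; norm_num at hp; linarith
  rw [← hx]
  have h1 : Real.arctan (Real.tan x) = x := Real.arctan_tan (by linarith) (by linarith)
  rw [← h1]
  apply Real.arctan_mono
  apply Real.le_sqrt_of_sq_le
  have hs : Real.sin x ≤ x := Real.sin_le hx0.le
  have hs0 : 0 ≤ Real.sin x := Real.sin_nonneg_of_nonneg_of_le_pi hx0.le (by linarith)
  have hc := Real.one_sub_sq_div_two_le_cos (x := x)
  have hx2 : x^2 ≤ (1429/10000)^2 := pow_le_pow_left₀ hx0.le hx1 2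
  have hc2 : 98/100 ≤ Real.cos x := by norm_num at hx2; linarith
  have hc2 : 9895/10000 ≤ Real.cos x := by norm_num at hx2; linarith
  have hc3 : (9895/10000)^2 ≤ Real.cos x ^2 := pow_le_pow_left₀ (by norm_num) hc2 2
  have hs2 : Real.sin x ^2 ≤ (1429/10000)^2 := pow_le_pow_left₀ hs0 (hs.trans hx1) 2
  rw [Real.tan_eq_sin_div_cos, div_pow, div_le_iff₀ (by positivity)]
  norm_num at hc3 hs2
  nlinarith

theorem pz_sin_arctan (x : ℝ) : Real.sin (Real.arctan x) = x * Real.cos (Real.arctan x) := by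
  rw [Real.sin_arctan, Real.cos_arctan]; ring

theorem pz_cos_two_arctan {U V : ℝ} (hU : 0 ≤ U) (hV : 0 < V) :
    Real.cos (2 * Real.arctan √(U/V)) = (V - U) / (U + V) := by
  rw [Real.cos_two_mul, Real.cos_sq_arctan, Real.sq_sqrt (by positivity)]
  field_simp
  ring

theorem pz_sin_A {S d t u θ ψ : ℝ} (n : ℕ) (hθ : θ = Real.arctan u) (hψ : ψ = Real.arctan t)
    (hr : (2*n+1) * θ = Real.pi + ψ) (h : (d - S) * t = (d + S) * u) :
    S * Real.sin ((n+1) * (2*θ)) = d * Real.sin (n * (2*θ)) := by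
  have e1 : (n+1) * (2*θ) = (ψ + θ) + Real.pi := by linarith
  have e2 : n * (2*θ) = (ψ - θ) + Real.pi := by linarith
  rw [e1, e2, Real.sin_add_pi, Real.sin_add_pi, Real.sin_add, Real.sin_sub, hθ, hψ,
    pz_sin_arctan, pz_sin_arctan]
  linear_combination (Real.cos (Real.arctan t) * Real.cos (Real.arctan u)) * h

theorem pz_sin_B {S d t u θ χ : ℝ} (n : ℕ) (hθ : θ = Real.arctan u) (hχ : χ = Real.arctan t)
    (hr : (2*n+1) * θ = Real.pi / 2 - χ) (h : (d - S) = (d + S) * (t * u)) :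
    S * Real.sin ((n+1) * (2*θ)) = d * Real.sin (n * (2*θ)) := by
  have e1 : (n+1) * (2*θ) = Real.pi / 2 - (χ - θ) := by linarith
  have e2 : n * (2*θ) = Real.pi / 2 - (χ + θ) := by linarith
  rw [e1, e2, Real.sin_pi_div_two_sub, Real.sin_pi_div_two_sub, Real.cos_add, Real.cos_sub, hθ, hχ,
    pz_sin_arctan, pz_sin_arctan]
  linear_combination -(Real.cos (Real.arctan t) * Real.cos (Real.arctan u)) * h

theorem pz_XA_gt {i j : ℝ} (hi : i ∈ Set.Icc (1/5 : ℝ) 1) (hj : j ∈ Set.Icc (0 : ℝ) (1/36))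
    (hj0 : 0 < j) (h : 4 * pzτB i j ≤ pzτA i j) : j * pzS i j < pzXA i j := by
  by_contra hX
  have hX := not_lt.mp hX
  have hMA := pz_MA_ge hi hj
  have hMB := pz_MB_bd hi hj
  have hXB := pz_XB_bd hi hj
  have hE := pz_E_pos hi hj
  have hS := pz_S_pos hi hj
  have hs := pz_s_bd hi hj
  have hS1 : pzS i j ≤ 1 := by unfold pzS; linarith
  obtain ⟨i1, i2⟩ := hi
  have hMA0 : 0 < pzMA i j := by linarith
  have hMB0 : 0 < pzMB i j := by linarith
  have hi0 : 0 < i := by linarith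
  have hE0 : 0 < pzE i j := by linarith
  unfold pzτA pzτB at h
  rw [← mul_div_assoc, div_le_div_iff₀ (by positivity) (by positivity)] at h
  have k : pzE i j * j * (4 * pzXB i j * ((1+i)^2 * pzMA i j)) ≤
      pzE i j * j * (i * pzS i j * ((1+j)^2 * pzMB i j)) := by
    calc _ = 4 * (pzE i j * j * pzXB i j) * ((1+i)^2 * pzMA i j) := by ring
      _ ≤ _ := h
      _ = (pzE i j * i * ((1+j)^2 * pzMB i j)) * pzXA i j := by ring
      _ ≤ (pzE i j * i * ((1+j)^2 * pzMB i j)) * (j * pzS i j) :=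
        mul_le_mul_of_nonneg_left hX (by positivity)
      _ = _ := by ring
  have k := le_of_mul_le_mul_left k (by positivity)
  have k1 : 4 * (5/6) * ((1+2*i) * i) ≤ 4 * pzXB i j * ((1+i)^2 * pzMA i j) := by
    apply mul_le_mul (by linarith) _ (by positivity) (by linarith)
    apply mul_le_mul _ hMA hi0.le (by positivity)
    linarith [sq_nonneg i, (by ring : (1+i)^2 = 1+2*i+i^2)]
  have k2 : i * pzS i j * ((1+j)^2 * pzMB i j) ≤ i * 1 * ((11/10) * (4*i+1/9)) := by
    apply mul_le_mul (mul_le_mul_of_nonneg_left hS1 hi0.le) _ (by positivity) (by positivity)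
    apply mul_le_mul _ _ hMB0.le (by positivity)
    · have := pow_le_pow_left₀ (by linarith : 0 ≤ 1+j) (by linarith [hj.2] : 1+j ≤ 37/36) 2
      norm_num at this; linarith
    · linarith [hMB.2, hj.2]
  nlinarith [mul_pos hi0 hi0]

theorem pz_cont_τA : ContinuousOn (fun z : ℝ × ℝ => pzτA z.1 z.2)
    (Set.Icc (1/5 : ℝ) 1 ×ˢ Set.Icc (0 : ℝ) (1/36)) := by
  unfold pzτA
  refine ContinuousOn.div ?_ ?_ ?_
  · unfold pzE pzXA; fun_prop
  · unfold pzMA; fun_prop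
  · rintro ⟨i, j⟩ ⟨hi, hj⟩
    have := pz_MA_ge hi hj
    have hi1 := hi.1
    have : 0 < pzMA i j := by simp at *; linarith
    have : 0 < i := by simp at *; linarith
    positivity

theorem pz_cont_SA : ContinuousOn (fun z : ℝ × ℝ => pzSA z.1 z.2)
    (Set.Icc (1/5 : ℝ) 1 ×ˢ Set.Icc (0 : ℝ) (1/36)) := by
  unfold pzSA
  refine ContinuousOn.div ?_ ?_ ?_
  · unfold pzXA; fun_prop
  · unfold pzMA pzE; fun_prop
  · rintro ⟨i, j⟩ ⟨hi, hj⟩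
    have := pz_MA_ge hi hj
    have := pz_E_pos hi hj
    have hi1 := hi.1
    have : 0 < pzMA i j := by simp at *; linarith
    have : 0 < pzE i j := by simp at *; linarith
    have : 0 < i := by simp at *; linarith
    positivity

theorem pz_cont_τB : ContinuousOn (fun z : ℝ × ℝ => pzτB z.1 z.2)
    (Set.Icc (1/5 : ℝ) 1 ×ˢ Set.Icc (0 : ℝ) (1/36)) := by
  unfold pzτB
  refine ContinuousOn.div ?_ ?_ ?_
  · unfold pzE pzXB; fun_prop
  · unfold pzMB; fun_prop
  · rintro ⟨i, j⟩ ⟨hi, hj⟩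
    have := (pz_MB_bd hi hj).1
    have hi1 := hi.1
    have hj1 := hj.1
    have : 0 < pzMB i j := by simp at *; linarith
    have : 0 ≤ j := by simp at *; linarith
    positivity

theorem pz_cont_TB : ContinuousOn (fun z : ℝ × ℝ => pzTB z.1 z.2)
    (Set.Icc (1/5 : ℝ) 1 ×ˢ Set.Icc (0 : ℝ) (1/36)) := by
  unfold pzTB
  refine ContinuousOn.div ?_ ?_ ?_
  · unfold pzE pzMB; fun_prop
  · unfold pzXB; fun_prop
  · rintro ⟨i, j⟩ ⟨hi, hj⟩
    have h1 := (pz_XB_bd hi hj).1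
    have h2 := pz_s_bd hi hj
    have hj1 := hj.1
    have : 0 < pzXB i j := by simp at *; linarith
    have : 0 < 2 + j - i*j := by simp at *; linarith
    positivity


theorem pz_exists_sol (a b : ℕ) (ha : 3 ≤ a) (hb : 5 ≤ b) :
    ∃ i ∈ Set.Icc (1/5 : ℝ) 1, ∃ j ∈ Set.Icc (0 : ℝ) (1/36),
      (2*b+1) * Real.arctan √(pzτB i j) + Real.arctan √(pzTB i j) - Real.pi / 2 = 0 ∧
      (2*a+1) * Real.arctan √(pzτA i j) - Real.arctan √(pzSA i j) - Real.pi = 0 := by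
  have hp0 := Real.pi_pos
  have ha' : (3 : ℝ) ≤ a := by exact_mod_cast ha
  have hb' : (5 : ℝ) ≤ b := by exact_mod_cast hb
  have hGc : ContinuousOn (fun z : ℝ × ℝ => (2*b+1) * Real.arctan √(pzτB z.1 z.2) +
      Real.arctan √(pzTB z.1 z.2) - Real.pi / 2)
      (Set.Icc (1/5 : ℝ) 1 ×ˢ Set.Icc (0 : ℝ) (1/36)) := by
    have h1 := Real.continuous_arctan.comp_continuousOn (Real.continuous_sqrt.comp_continuousOn pz_cont_τB)
    have h2 := Real.continuous_arctan.comp_continuousOn (Real.continuous_sqrt.comp_continuousOn pz_cont_TB)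
    exact ((continuousOn_const.mul h1).add h2).sub continuousOn_const
  have hHc : ContinuousOn (fun z : ℝ × ℝ => (2*a+1) * Real.arctan √(pzτA z.1 z.2) -
      Real.arctan √(pzSA z.1 z.2) - Real.pi)
      (Set.Icc (1/5 : ℝ) 1 ×ˢ Set.Icc (0 : ℝ) (1/36)) := by
    have h1 := Real.continuous_arctan.comp_continuousOn (Real.continuous_sqrt.comp_continuousOn pz_cont_τA)
    have h2 := Real.continuous_arctan.comp_continuousOn (Real.continuous_sqrt.comp_continuousOn pz_cont_SA)
    exact ((continuousOn_const.mul h1).sub h2).sub continuousOn_const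
  refine pz_ivt2 (by norm_num) (by norm_num)
    (fun i j => (2*b+1) * Real.arctan √(pzτB i j) + Real.arctan √(pzTB i j) - Real.pi / 2)
    (fun i j => (2*a+1) * Real.arctan √(pzτA i j) - Real.arctan √(pzSA i j) - Real.pi)
    ?_ ?_ ?_ ?_ ?_ hHc ?_ ?_
  · intro j hj
    exact hGc.comp (f := fun i => (i, j)) (by fun_prop) (fun i hi => ⟨hi, hj⟩)
  · intro i hi
    exact hGc.comp (f := fun j => (i, j)) (by fun_prop) (fun j hj => ⟨hi, hj⟩)
  · intro i hi j1 h1 j2 h2 hlt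
    have t0 : 0 ≤ pzτB i j1 := by
      have h0 : pzτB i 0 = 0 := by simp [pzτB]
      rw [← h0]
      exact (pz_τB_mono hi).monotoneOn (by constructor <;> norm_num) h1 h1.1
    have e1 := Real.arctan_strictMono (Real.sqrt_lt_sqrt t0 (pz_τB_mono hi h1 h2 hlt))
    have e2 := Real.arctan_mono (Real.sqrt_le_sqrt (pz_TB_mono hi h1 h2 hlt.le))
    have e3 := mul_lt_mul_of_pos_left e1 (by linarith : (0 : ℝ) < 2*b+1)
    show _ < _
    simp only
    linarith
  · intro i hi
    simp [pzτB, pzTB]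
    linarith
  · intro i hi
    have e1 := pz_arctan_ge (pz_τB_end hi)
    have e2 := Real.arctan_nonneg.mpr (Real.sqrt_nonneg (pzTB i (1/36)))
    have e3 : (11 : ℝ) * (Real.pi / 22) ≤ (2*b+1) * Real.arctan √(pzτB i (1/36)) :=
      mul_le_mul (by linarith) e1 (by positivity) (by linarith)
    show 0 ≤ _ - _
    linarith
  · intro j hj
    have e1 : Real.pi / 4 ≤ Real.arctan √(pzτA (1/5) j) := by
      rw [← Real.arctan_one]
      exact Real.arctan_mono (Real.le_sqrt_of_sq_le (by simpa using pz_τA_start hj))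
    have e2 := Real.arctan_lt_pi_div_two √(pzSA (1/5) j)
    have e3 : (7 : ℝ) * (Real.pi / 4) ≤ (2*a+1) * Real.arctan √(pzτA (1/5) j) :=
      mul_le_mul (by linarith) e1 (by positivity) (by linarith)
    show 0 ≤ _ - _ - _
    linarith
  · intro j hj
    have hi : (1 : ℝ) ∈ Set.Icc (1/5 : ℝ) 1 := by constructor <;> norm_num
    have hX : pzXA 1 j ≤ 0 := by unfold pzXA; nlinarith [hj.1]
    have hM := pz_MA_ge hi hj
    have hE := pz_E_pos hi hj
    have t1 : pzτA 1 j ≤ 0 := by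
      unfold pzτA
      apply div_nonpos_of_nonpos_of_nonneg
      · exact mul_nonpos_of_nonneg_of_nonpos (by linarith) hX
      · exact mul_nonneg (by positivity) (by linarith)
    show (2*a+1) * Real.arctan √(pzτA 1 j) - Real.arctan √(pzSA 1 j) - Real.pi ≤ 0
    rw [Real.sqrt_eq_zero_of_nonpos t1, Real.arctan_zero]
    have e2 := Real.arctan_nonneg.mpr (Real.sqrt_nonneg (pzSA 1 j))
    linarith

theorem pz_final (p q : ℤ) (a b : ℕ) (hp : p = 2*a+1) (hq : q = 2*b+1) (ha : 3 ≤ a) (hb : 5 ≤ b)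
    (hab : a ≤ b) : Infinite (PresentedGroup (pretzelRels p q (2*(p+q)+1))) := by
  obtain ⟨i, hi, j, hj, hG, hH⟩ := pz_exists_sol a b ha hb
  have hp0 := Real.pi_pos
  have ha' : (3 : ℝ) ≤ a := by exact_mod_cast ha
  have hb' : (5 : ℝ) ≤ b := by exact_mod_cast hb
  have hab' : (a : ℝ) ≤ b := by exact_mod_cast hab
  have hS : 0 < pzS i j := by linarith [pz_S_pos hi hj]
  have hY := pz_Y_pos hi hj
  have hE : 0 < pzE i j := by linarith [pz_E_pos hi hj]
  have hi0 : 0 < i := by linarith [hi.1]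
  have hMA : 0 < pzMA i j := by linarith [pz_MA_ge hi hj]
  have hMB : 0 < pzMB i j := by linarith [(pz_MB_bd hi hj).1]
  have hXB : 0 < pzXB i j := by linarith [(pz_XB_bd hi hj).1]
  have hj0 : 0 < j := by
    rcases hj.1.eq_or_lt with h | h
    · rw [← h] at hG
      simp [pzτB, pzTB] at hG
    · exact h
  have hs := pz_s_bd hi hj
  have hψ := Real.arctan_nonneg.mpr (Real.sqrt_nonneg (pzSA i j))
  have hχ := Real.arctan_nonneg.mpr (Real.sqrt_nonneg (pzTB i j))
  have hτA : 0 < pzτA i j := by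
    by_contra h
    rw [Real.sqrt_eq_zero_of_nonpos (not_lt.mp h), Real.arctan_zero] at hH
    linarith
  have hXA : 0 < pzXA i j := by
    by_contra h
    apply not_le.mpr hτA
    unfold pzτA
    exact div_nonpos_of_nonpos_of_nonneg
      (mul_nonpos_of_nonneg_of_nonpos (by positivity) (not_lt.mp h)) (by positivity)
  have hτB : 0 < pzτB i j := by unfold pzτB; positivity
  obtain ⟨θA, hθA⟩ : ∃ θ, θ = Real.arctan √(pzτA i j) := ⟨_, rfl⟩
  obtain ⟨θB, hθB⟩ : ∃ θ, θ = Real.arctan √(pzτB i j) := ⟨_, rfl⟩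
  rw [← hθA] at hH
  rw [← hθB] at hG
  have hA0 : 0 < θA := by rw [hθA]; exact Real.arctan_pos.mpr (Real.sqrt_pos.mpr hτA)
  have hB0 : 0 < θB := by rw [hθB]; exact Real.arctan_pos.mpr (Real.sqrt_pos.mpr hτB)
  have hA1 : θA < Real.pi / 2 := by rw [hθA]; exact Real.arctan_lt_pi_div_two _
  have hB1 : θB < Real.pi / 2 := by rw [hθB]; exact Real.arctan_lt_pi_div_two _
  have hB2 : θB ≤ Real.pi / 22 := by nlinarith
  have hAB : 2 * θB ≤ θA := by nlinarith
  have hcosA : Real.cos (2 * θA) = pzca i j := by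
    rw [hθA]; unfold pzτA
    rw [pz_cos_two_arctan (by positivity) (by positivity), pz_key_A, pzca, pzNA]
    have hk := pz_key_A (i := i) (j := j)
    rw [div_eq_div_iff (by positivity) (by positivity)]
    linear_combination (2 * pzS i j * pzY i j) * hk
  have hcosB : Real.cos (2 * θB) = pzcb i j := by
    rw [hθB]; unfold pzτB
    rw [pz_cos_two_arctan (by positivity) (by positivity), pz_key_B, pzcb, pzNB]
    have hk := pz_key_B (i := i) (j := j)
    rw [div_eq_div_iff (by positivity) (by positivity)]
    linear_combination (2 * pzS i j * pzY i j) * hk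
  have hden : 0 < 2 + i - i*j := by linarith [hj.2]
  have hdenB : 0 < 2 + j - i*j := by linarith [hj.2]
  refine pz_infinite_of_params p q a b hp hq i j (2*θA) (2*θB) hi0 hj0 hS hY hE hcosA hcosB
    (Real.sin_pos_of_pos_of_lt_pi (by linarith) (by linarith)).ne'
    (Real.sin_pos_of_pos_of_lt_pi (by linarith) (by linarith)).ne' ?_ ?_ ?_ ?_
  · refine pz_sin_A a hθA rfl (by linarith) (t := √(pzSA i j)) ?_
    have e1 : pzdA i j - pzS i j = i * pzE i j := by unfold pzdA pzS pzE; ring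
    have e2 : pzdA i j + pzS i j = (1+i)*(2+i-i*j) := by unfold pzdA pzS; ring
    have e3 : pzτA i j = (i * pzE i j / ((1+i)*(2+i-i*j)))^2 * pzSA i j := by
      unfold pzτA pzSA
      field_simp
    rw [e1, e2, e3, Real.sqrt_mul (by positivity), Real.sqrt_sq (by positivity)]
    field_simp
  · refine pz_sin_B b hθB rfl (by linarith) (t := √(pzTB i j)) ?_
    have e1 : pzdB i j - pzS i j = j * pzE i j := by unfold pzdB pzS pzE; ring
    have e2 : pzdB i j + pzS i j = (1+j)*(2+j-i*j) := by unfold pzdB pzS; ring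
    have e3 : pzTB i j * pzτB i j = (j * pzE i j / ((1+j)*(2+j-i*j)))^2 := by
      unfold pzτB pzTB
      field_simp
    have hT : 0 ≤ pzTB i j := by unfold pzTB; positivity
    rw [← Real.sqrt_mul hT, e1, e2, e3, Real.sqrt_sq (by positivity), mul_div_cancel₀]
    positivity
  · rw [← hcosB]
    have h1 := Real.one_sub_sq_div_two_le_cos (x := 2 * θB)
    have h2 : 2 * θB ≤ 2/5 := by linarith [Real.pi_lt_four]
    have h3 : (2*θB)^2 ≤ (2/5)^2 := pow_le_pow_left₀ (by linarith) h2 2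
    norm_num at h3
    linarith
  · apply pz_D_pos hi0 hj0 hS hY hE
    apply pz_XA_gt hi hj hj0
    have hx0 := Real.sqrt_pos.mpr hτB
    have hx1 : √(pzτB i j) < 1 := by
      rw [← Real.arctan_strictMono.lt_iff_lt, Real.arctan_one, ← hθB]
      linarith
    have hx2 : √(pzτB i j)^2 < 1 := by nlinarith
    rw [hθA, hθB, Real.two_mul_arctan (by linarith) hx1, Real.arctan_strictMono.le_iff_le] at hAB
    have h3 : 2 * √(pzτB i j) ≤ √(pzτA i j) := by
      refine le_trans ?_ hAB
      rw [le_div_iff₀ (by linarith)]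
      nlinarith [sq_nonneg √(pzτB i j)]
    have h4 := pow_le_pow_left₀ (by positivity) h3 2
    rw [mul_pow, Real.sq_sqrt hτA.le, Real.sq_sqrt hτB.le] at h4
    linarith

/-- `2(p+q)+1` surgery on the `(-2,p,q)` pretzel knot (with `p,q` odd, `7 ≤ p ≤ q`,
`q ≥ 21` when `p = 7`, and `(p,q) ≠ (9,9)`) has infinite fundamental group. -/
theorem surgery_2pq_plus_one_infinite (p q : ℤ) (hp : Odd p) (hq : Odd q)
    (hp7 : 7 ≤ p) (hpq : p ≤ q) (hq21 : p = 7 → 21 ≤ q) (hne : ¬(p = 9 ∧ q = 9)) :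
    Infinite (PresentedGroup (pretzelRels p q (2 * (p + q) + 1))) := by
  obtain ⟨a, ha⟩ := hp
  obtain ⟨b, hb⟩ := hq
  have h1 : (a.toNat : ℤ) = a := Int.toNat_of_nonneg (by omega)
  have h2 : (b.toNat : ℤ) = b := Int.toNat_of_nonneg (by omega)
  exact pz_final p q a.toNat b.toNat (by omega) (by omega) (by omega) (by omega) (by omega)
end

section
/- Let p and q be odd integers with 5 ≤ p ≤ q. Then there is a surjective group homomorphism from the presented group Γ_{2(p+q)-1}(p,q) onto Coxeter's group G^{5,p,q}. -/
/-- The relators of Coxeter's group `G^{m,p,q}` on generators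
`A = of 0`, `B = of 1`, `C = of 2`. -/
def coxeterGRels (m p q : ℤ) : Set (FreeGroup (Fin 3)) :=
  let A : FreeGroup (Fin 3) := FreeGroup.of 0
  let B : FreeGroup (Fin 3) := FreeGroup.of 1
  let C : FreeGroup (Fin 3) := FreeGroup.of 2
  { A ^ p, B ^ q, C ^ m, (A * B) ^ 2, (B * C) ^ 2, (C * A) ^ 2, (A * B * C) ^ 2 }

section helpers

variable {G : Type*} [Group G] {A B C : G}

theorem aux_key (h1 : (A * B) ^ 2 = 1) (h2 : (B * C) ^ 2 = 1) (h3 : (C * A) ^ 2 = 1)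
    (h4 : (A * B * C) ^ 2 = 1) : A ^ 2 * B ^ 2 * C ^ 2 = 1 := by
  have e1 : A * B = B⁻¹ * A⁻¹ := by
    rw [← mul_inv_rev, eq_inv_iff_mul_eq_one, ← sq, h1]
  have e2 : C * B * C = B⁻¹ := by
    rw [eq_inv_iff_mul_eq_one, ← mul_eq_one_comm]
    rw [sq] at h2
    simpa [mul_assoc] using h2
  have e3 : C * A * C = A⁻¹ := by
    rw [eq_inv_iff_mul_eq_one]
    rw [sq] at h3
    simpa [mul_assoc] using h3
  have e4 : C * (A * B) * C = A * B := by
    have h5 : A * B * (C * (A * B) * C) = 1 := by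
      rw [sq] at h4
      simpa [mul_assoc] using h4
    have h6 : A * B * (A * B) = 1 := by rw [← sq, h1]
    exact mul_left_cancel (h5.trans h6.symm)
  have e5 : C * (A * B) * C = (C * A * C) * (C ^ 2)⁻¹ * (C * B * C) := by group
  rw [e4, e2, e3] at e5
  have e6 : A ^ 2 * B ^ 2 = A * (A * B) * B := by simp only [sq, mul_assoc]
  rw [e6, e5]
  group

theorem aux_pow {g : G} {a : ℤ} (h : g ^ (2 * a + 1) = 1) : (g ^ (2 : ℤ)) ^ a = g⁻¹ := by
  rw [← zpow_mul, eq_inv_iff_mul_eq_one, ← zpow_add_one, h]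

theorem aux_pow1 {g : G} {a : ℤ} (h : g ^ (2 * a + 1) = 1) : (g ^ (2 : ℤ)) ^ (a + 1) = g := by
  rw [zpow_add_one, aux_pow h]; group

end helpers

/-- For `p,q` odd with `5 ≤ p ≤ q`, the group `Γ_{2(p+q)-1}(p,q)` surjects onto
Coxeter's group `G^{5,p,q}`. -/
theorem gamma_surjects_onto_G5pq (p q : ℤ) (hp : Odd p) (hq : Odd q)
    (hp5 : 5 ≤ p) (hpq : p ≤ q) :
    ∃ f : PresentedGroup (pretzelRels p q (2 * (p + q) - 1)) →*
        PresentedGroup (coxeterGRels 5 p q),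
      Function.Surjective f := by
  obtain ⟨a, rfl⟩ := hp
  obtain ⟨b, rfl⟩ := hq
  set R := coxeterGRels 5 (2 * a + 1) (2 * b + 1) with hR
  let A : PresentedGroup R := PresentedGroup.of 0
  let B : PresentedGroup R := PresentedGroup.of 1
  let C : PresentedGroup R := PresentedGroup.of 2
  have rel : ∀ r ∈ R, PresentedGroup.mk R r = 1 := fun r hr =>
    PresentedGroup.one_of_mem hr
  have hA : A ^ (2 * a + 1) = 1 := rel (FreeGroup.of 0 ^ (2 * a + 1)) (by simp [hR, coxeterGRels])
  have hB : B ^ (2 * b + 1) = 1 := rel (FreeGroup.of 1 ^ (2 * b + 1)) (by simp [hR, coxeterGRels])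
  have hC : C ^ (5 : ℤ) = 1 := rel (FreeGroup.of 2 ^ (5 : ℤ)) (by simp [hR, coxeterGRels])
  have h1 : (A * B) ^ 2 = 1 :=
    rel ((FreeGroup.of 0 * FreeGroup.of 1) ^ 2) (by simp [hR, coxeterGRels])
  have h2 : (B * C) ^ 2 = 1 :=
    rel ((FreeGroup.of 1 * FreeGroup.of 2) ^ 2) (by simp [hR, coxeterGRels])
  have h3 : (C * A) ^ 2 = 1 :=
    rel ((FreeGroup.of 2 * FreeGroup.of 0) ^ 2) (by simp [hR, coxeterGRels])
  have h4 : (A * B * C) ^ 2 = 1 :=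
    rel ((FreeGroup.of 0 * FreeGroup.of 1 * FreeGroup.of 2) ^ 2) (by simp [hR, coxeterGRels])
  have hgen : Subgroup.closure {A, B, C} = ⊤ := by
    rw [← PresentedGroup.closure_range_of R]
    congr 1
    ext g
    simp [Fin.exists_fin_succ, A, B, C, eq_comm]
  clear_value A B C
  have key := aux_key h1 h2 h3 h4
  have hAB : A * B = B⁻¹ * A⁻¹ := by
    rw [← mul_inv_rev, eq_inv_iff_mul_eq_one, ← sq, h1]
  have hBC : B * C = C⁻¹ * B⁻¹ := by
    rw [← mul_inv_rev, eq_inv_iff_mul_eq_one, ← sq, h2]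
  have hABC : A * B * C * (A * B) = C⁻¹ := by
    rw [eq_inv_iff_mul_eq_one, ← h4, sq]; group
  have hC4 : C ^ (4 : ℤ) = C⁻¹ := by
    rw [eq_inv_iff_mul_eq_one, ← zpow_add_one, ← hC]; rfl
  have e : A * B * C * B⁻¹ * A⁻¹ = C⁻¹ := by
    rw [← hABC, mul_assoc _ B⁻¹ A⁻¹, ← hAB]
  have e1 : A⁻¹ * C⁻¹ * A = B * C * B⁻¹ := by
    rw [← e]; group
  -- the images of the generators
  let x := B * C * B⁻¹
  have hx : x = C⁻¹ * B ^ (-2 : ℤ) := by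
    show B * C * B⁻¹ = _
    rw [hBC]; group
  have hA2 : A ^ (2 : ℤ) = C ^ (-2 : ℤ) * B ^ (-2 : ℤ) := by
    have : A ^ (2 : ℤ) = (A ^ 2 * B ^ 2 * C ^ 2) * (C ^ (-2 : ℤ) * B ^ (-2 : ℤ)) := by group
    rw [this, key, one_mul]
  have hyx : C * x = (B⁻¹) ^ (2 : ℤ) := by rw [hx]; group
  have hzx : C⁻¹ * x = A ^ (2 : ℤ) := by rw [hx, hA2]; group
  have hBi : (B⁻¹) ^ (2 * b + 1) = 1 := by rw [inv_zpow, hB, inv_one]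
  have ya : (C * x) ^ b = B := by rw [hyx, aux_pow hBi, inv_inv]
  have ya1 : (C * x) ^ (b + 1) = B⁻¹ := by rw [hyx, aux_pow1 hBi]
  have za : (C⁻¹ * x) ^ a = A⁻¹ := by rw [hzx, aux_pow hA]
  have za1 : (C⁻¹ * x) ^ (a + 1) = A := by rw [hzx, aux_pow1 hA]
  have d1 : (2 * a + 1 - 1) / 2 = a := by omega
  have d2 : (2 * a + 1 + 1) / 2 = a + 1 := by omega
  have d3 : (2 * b + 1 - 1) / 2 = b := by omega
  have d4 : (2 * b + 1 + 1) / 2 = b + 1 := by omega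
  have hf : ∀ r ∈ pretzelRels (2 * a + 1) (2 * b + 1) (2 * (2 * a + 1 + (2 * b + 1)) - 1),
      FreeGroup.lift ![x, C, C⁻¹] r = 1 := by
    intro r hr
    simp only [pretzelRels, Set.mem_insert_iff, Set.mem_singleton_iff, d1, d2, d3, d4] at hr
    rcases hr with rfl | rfl | rfl | rfl <;>
      simp only [map_mul, map_inv, map_zpow, FreeGroup.lift_apply_of, Matrix.cons_val_zero,
        Matrix.cons_val_one, Matrix.cons_val, zpow_neg, ya, ya1, za, za1]
    · -- first relator
      rw [inv_inv, inv_inv, e1]; group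
    · -- second relator
      simp only [x]; group
    · -- third relator
      have e2 : A * x * A⁻¹ = C⁻¹ := by rw [← e]; simp only [x]; group
      rw [e2]; group
    · -- surgery relator
      have e2 : A⁻¹ * (C * C) * A = B * (C * C)⁻¹ * B⁻¹ := by
        have h5 : A⁻¹ * (C * C) * A = ((A⁻¹ * C⁻¹ * A) * (A⁻¹ * C⁻¹ * A))⁻¹ := by simp [mul_assoc]
        rw [h5, e1]; group
      have e3 : B * (C * C)⁻¹ * B⁻¹ * (A⁻¹ * (C * C) * A) = x := by
        have h5 : x = B * (C ^ (4 : ℤ))⁻¹ * B⁻¹ := by rw [hC4, inv_inv]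
        rw [e2, h5]; group
      have e4 : ∀ n : ℤ, x ^ (2 * n - 1) * (x ^ (-2 * n) * x) = 1 := by intro n; group
      rw [← e4 (2 * a + 1 + (2 * b + 1))]
      nth_rewrite 5 [← e3]
      simp only [inv_inv, mul_assoc]
  refine ⟨PresentedGroup.toGroup (f := ![x, C, C⁻¹]) hf, ?_⟩
  rw [← MonoidHom.range_eq_top, eq_top_iff, ← hgen, Subgroup.closure_le]
  set F := PresentedGroup.toGroup (f := ![x, C, C⁻¹]) hf
  have mC : C ∈ F.range := ⟨PresentedGroup.of 1, by simp [F]⟩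
  have mx : x ∈ F.range := ⟨PresentedGroup.of 0, by simp [F]⟩
  have mB : B ∈ F.range := ya ▸ F.range.zpow_mem (F.range.mul_mem mC mx) b
  have mA : A ∈ F.range :=
    za1 ▸ F.range.zpow_mem (F.range.mul_mem (F.range.inv_mem mC) mx) (a + 1)
  rintro g (rfl | rfl | rfl)
  exacts [mA, mB, mC]
end
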